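/- arXiv:2402.01358 — 11 statements merged into one kernel-verified Lean document; each statement's English description precedes it below -/
import Mathlib

section
/- Let G be a finite group, p a prime, and N a normal p-subgroup of G. Then N is contained in the hypercentre Z_∞(G) if and only if the quotient group G/C_G(N) is a p-group. -/
theorem centralizer_normal {G : Type*} [Group G] (N : Subgroup G) (hN : N.Normal) :
    (Subgroup.centralizer (N : Set G)).Normal := by
  refine ⟨fun c hc g => ?_⟩
  rw [Subgroup.mem_centralizer_iff] at hc ⊢
  intro n hn
  have h1 : g⁻¹ * n * g ∈ (N : Set G) := by
    simpa using hN.conj_mem n hn g⁻¹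
  have := hc _ h1
  calc n * (g * c * g⁻¹) = g * (g⁻¹ * n * g * c) * g⁻¹ := by group
    _ = g * (c * (g⁻¹ * n * g)) * g⁻¹ := by rw [this]
    _ = g * c * g⁻¹ * n := by group

theorem commute_pow_card_pow_of_mem_upperCentralSeries {G : Type*} [Group G] {N : Subgroup G}
    (hN : N.Normal) (g : G) (i : ℕ) {x : G} (hxN : x ∈ N)
    (hx : x ∈ Subgroup.upperCentralSeries G i) :
    Commute (g ^ Nat.card N ^ i) x := by
  induction i generalizing x with
  | zero =>
    obtain rfl : x = 1 := by simpa using hx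
    exact Commute.one_right _
  | succ i ih =>
    set h := g ^ Nat.card N ^ i
    have hcN : h * x * h⁻¹ * x⁻¹ ∈ N := N.mul_mem (hN.conj_mem x hxN h) (N.inv_mem hxN)
    have hcZ : h * x * h⁻¹ * x⁻¹ ∈ Subgroup.upperCentralSeries G i := by
      have := inv_mem (Subgroup.mem_upperCentralSeries_succ_iff.1 hx h)
      simpa [mul_assoc, commutatorElement_def] using this
    have hc := ih hcN hcZ
    set c := h * x * h⁻¹ * x⁻¹ with c_def
    have hconj : h * x = c * x * h := by simp [c_def]
    have hpow (m : ℕ) : h ^ m * x = c ^ m * x * h ^ m := by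
      induction m with
      | zero => simp
      | succ m ihm =>
        rw [pow_succ', mul_assoc, ihm, ← mul_assoc, ← mul_assoc, (hc.pow_right m).eq,
          mul_assoc (c ^ m), hconj, pow_succ c]
        simp only [mul_assoc]
    have hc1 : c ^ Nat.card N = 1 :=
    congrArg Subtype.val (pow_card_eq_one' (x := (⟨c, hcN⟩ : N)))
    have := hpow (Nat.card N)
    rw [hc1, one_mul, ← pow_mul, ← pow_succ] at this
    exact this

/-- A nontrivial normal `p`-subgroup on which every element acts with `p`-power order
meets the centre nontrivially. -/
theorem exists_mem_center_ne_one_of_pow_mem_centralizer {G : Type*} [Group G] [Finite G] {p : ℕ}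
    (hp : p.Prime) {N : Subgroup G} (hN : N.Normal) (hNp : IsPGroup p N) (hbot : N ≠ ⊥)
    (h : ∀ g : G, ∃ k, g ^ p ^ k ∈ Subgroup.centralizer (N : Set G)) :
    ∃ x ∈ N, x ∈ Subgroup.center G ∧ x ≠ 1 := by
  have := Fact.mk hp
  have hQ : IsPGroup p (MulAut.conjNormal (H := N)).range := by
    rintro ⟨_, g, rfl⟩
    obtain ⟨k, hk⟩ := h g
    refine ⟨k, Subtype.ext ?_⟩
    ext x
    have := Subgroup.mem_centralizer_iff.1 hk x x.2
    simp [← map_pow, ← this]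
  have : Nontrivial N := (Subgroup.nontrivial_iff_ne_bot N).2 hbot
  have hdvd : p ∣ Nat.card N := by
    obtain ⟨n, hn, hcard⟩ := hNp.nontrivial_iff_card.1 ‹_›
    exact hcard ▸ dvd_pow_self p hn.ne'
  have hone : (1 : N) ∈ MulAction.fixedPoints (MulAut.conjNormal (H := N)).range N := by
    rintro ⟨f, _⟩
    exact map_one f
  obtain ⟨x, hx, hx1⟩ := hQ.exists_fixed_point_of_prime_dvd_card_of_fixed_point N hdvd hone
  refine ⟨x, x.2, Subgroup.mem_center_iff.2 fun g => ?_, fun hx' => hx1 (Subtype.ext hx'.symm)⟩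
  have : MulAut.conjNormal g x = x := hx ⟨_, g, rfl⟩
  have := congrArg Subtype.val this
  rw [MulAut.conjNormal_apply] at this
  exact mul_inv_eq_iff_eq_mul.1 this

theorem isPGroup_quotient_iff_pow_mem {G : Type*} [Group G] {p : ℕ} (H : Subgroup G) [H.Normal] :
    IsPGroup p (G ⧸ H) ↔ ∀ g : G, ∃ k, g ^ p ^ k ∈ H := by
  rw [isPGroup_iff_pow_pow_eq_one, (QuotientGroup.mk_surjective (s := H)).forall]
  simp [← QuotientGroup.mk_pow, QuotientGroup.eq_one_iff]

theorem exists_iSup_upperCentralSeries_eq (G : Type*) [Group G] [Finite G] :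
    ∃ n, ⨆ i, Subgroup.upperCentralSeries G i = Subgroup.upperCentralSeries G n :=
  ⟨_, WellFoundedGT.iSup_eq_monotonicSequenceLimit
    ⟨Subgroup.upperCentralSeries G, Subgroup.upperCentralSeries_mono G⟩⟩

/-- The quotient by a stationary term of the upper central series has trivial centre. -/
theorem center_quotient_upperCentralSeries_eq_bot {G : Type*} [Group G] {n : ℕ}
    (h : Subgroup.upperCentralSeries G (n + 1) ≤ Subgroup.upperCentralSeries G n) :
    Subgroup.center (G ⧸ Subgroup.upperCentralSeries G n) = ⊥ := by
  rw [eq_bot_iff]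
  intro q hq
  obtain ⟨x, rfl⟩ := QuotientGroup.mk_surjective q
  refine (QuotientGroup.eq_one_iff x).2 (h (Subgroup.mem_upperCentralSeries_succ_iff.2 fun y => ?_))
  rw [← QuotientGroup.eq_one_iff]
  have := Subgroup.mem_center_iff.1 hq y
  simp [commutatorElement_def, ← this]

/-- A normal p-subgroup N of a finite group G lies in the hypercentre Z_∞(G)
iff G/C_G(N) is a p-group. -/
theorem stmt_0 {G : Type*} [Group G] [Finite G] (p : ℕ) (hp : p.Prime)
    (N : Subgroup G) (hN : N.Normal) (hNp : IsPGroup p N) :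
    haveI : (Subgroup.centralizer (N : Set G)).Normal := centralizer_normal N hN
    (N ≤ ⨆ n, upperCentralSeries G n ↔
      IsPGroup p (G ⧸ Subgroup.centralizer (N : Set G))) := by
  have := centralizer_normal N hN
  obtain ⟨n, hn⟩ := exists_iSup_upperCentralSeries_eq G
  change N ≤ ⨆ n, Subgroup.upperCentralSeries G n ↔
    IsPGroup p (G ⧸ Subgroup.centralizer (N : Set G))
  rw [isPGroup_quotient_iff_pow_mem, hn]
  constructor
  · intro hle g
    have := Fact.mk hp
    obtain ⟨m, hm⟩ := IsPGroup.iff_card.1 hNp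
    refine ⟨m * n, Subgroup.mem_centralizer_iff.2 fun x hx => ?_⟩
    have := commute_pow_card_pow_of_mem_upperCentralSeries hN g n hx (hle hx)
    rw [hm, ← pow_mul] at this
    exact this.symm.eq
  · intro h
    set Z := Subgroup.upperCentralSeries G n
    have hcenter : Subgroup.center (G ⧸ Z) = ⊥ :=
      center_quotient_upperCentralSeries_eq_bot ((le_iSup _ (n + 1)).trans hn.le)
    suffices hbot : N.map (QuotientGroup.mk' Z) = ⊥ by
      simpa [Subgroup.map_eq_bot_iff] using hbot
    by_contra hbot
    obtain ⟨x, -, hx, hx1⟩ := exists_mem_center_ne_one_of_pow_mem_centralizer hp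
      (hN.map _ (QuotientGroup.mk'_surjective Z)) (hNp.map _) hbot (fun q => by
        obtain ⟨g, rfl⟩ := QuotientGroup.mk'_surjective Z q
        obtain ⟨k, hk⟩ := h g
        refine ⟨k, Subgroup.mem_centralizer_iff.2 ?_⟩
        rintro _ ⟨y, hy, rfl⟩
        rw [← map_pow, ← map_mul, ← map_mul, Subgroup.mem_centralizer_iff.1 hk y hy])
    rw [hcenter, Subgroup.mem_bot] at hx
    exact hx1 hx
end

section
/- Let G be a finite group, p a prime, and x a p-element of G (an element whose order is a power of p). Then x lies in the hypercentre Z_∞(G) if and only if x commutes with every p'-element of G (every element whose order is not divisible by p). -/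
open scoped commutatorElement

open Subgroup in
/-- A nontrivial normal subgroup of a nilpotent group meets the centre nontrivially. -/
theorem exists_ne_one_mem_center_of_mem_normal {G : Type*} [Group G] [Group.IsNilpotent G]
    (N : Subgroup G) [N.Normal] {x : G} (hxN : x ∈ N) (hx : x ≠ 1) :
    ∃ z ∈ N, z ≠ 1 ∧ z ∈ center G := by
  obtain ⟨n, hn⟩ := Group.IsNilpotent.nilpotent G
  have hxn : x ∈ Subgroup.upperCentralSeries G n := hn ▸ mem_top x
  clear hn
  induction n generalizing x with
  | zero => exact absurd (mem_bot.mp hxn) hx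
  | succ n ih =>
    by_cases hc : x ∈ center G
    · exact ⟨x, hxN, hx, hc⟩
    · obtain ⟨y, hy⟩ : ∃ y : G, ⁅x, y⁆ ≠ 1 := by
        by_contra! h
        exact hc (mem_center_iff.mpr fun y => (commutatorElement_eq_one_iff_mul_comm.mp (h y)).symm)
      refine ih ?_ hy (Subgroup.mem_upperCentralSeries_succ_iff.mp hxn y)
      rw [commutatorElement_def, mul_assoc, mul_assoc, ← mul_assoc y]
      exact N.mul_mem hxN (Normal.conj_mem inferInstance _ (N.inv_mem hxN) y)

/-- Elements of coprime orders whose commutator is central commute. -/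
theorem commutatorElement_eq_one_of_mem_center_of_coprime {G : Type*} [Group G] {x y : G}
    {m n : ℕ} (hx : x ^ m = 1) (hy : y ^ n = 1) (hmn : m.Coprime n)
    (h : ⁅x, y⁆ ∈ Subgroup.center G) : ⁅x, y⁆ = 1 := by
  have hc (g : G) : Commute ⁅x, y⁆ g := (Subgroup.mem_center_iff.mp h g).symm
  have h₁ : ⁅x, y⁆ ^ n = 1 := by
    have e : ⁅x, y⁆ * y = x * y * x⁻¹ := by rw [commutatorElement_def]; group
    have := congrArg (· ^ n) e
    simpa [(hc y).mul_pow, conj_pow, hy] using this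
  have h₂ : ⁅x, y⁆ ^ m = 1 := by
    have e : ⁅x, y⁆⁻¹ * x = y * x * y⁻¹ := by rw [commutatorElement_def]; group
    have := congrArg (· ^ m) e
    simpa only [(hc x).inv_left.mul_pow, conj_pow, hx, mul_one, mul_inv_cancel, inv_pow,
      inv_eq_one] using this
  exact orderOf_eq_one_iff.mp
    (Nat.eq_one_of_dvd_coprimes hmn (orderOf_dvd_of_pow_eq_one h₂) (orderOf_dvd_of_pow_eq_one h₁))

/-- An element of the upper central series commutes with every element of coprime order. -/
theorem commute_of_mem_upperCentralSeries_of_coprime {G : Type*} [Group G] {x y : G} {n : ℕ}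
    (hx : x ∈ Subgroup.upperCentralSeries G n) (hxy : (orderOf x).Coprime (orderOf y)) :
    Commute x y := by
  have key (k : ℕ) (hk : ⁅x, y⁆ ∈ Subgroup.upperCentralSeries G k) : ⁅x, y⁆ = 1 := by
    induction k with
    | zero => exact Subgroup.mem_bot.mp hk
    | succ k ih =>
      refine ih ?_
      change ⁅x, y⁆ ∈ Subgroup.upperCentralSeriesStep (Subgroup.upperCentralSeries G k) at hk
      rw [Subgroup.upperCentralSeriesStep_eq_comap_center, Subgroup.mem_comap,
        map_commutatorElement] at hk
      rw [← QuotientGroup.eq_one_iff, ← QuotientGroup.mk'_apply, map_commutatorElement]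
      refine commutatorElement_eq_one_of_mem_center_of_coprime ?_ ?_ hxy hk
      · rw [← map_pow, pow_orderOf_eq_one, map_one]
      · rw [← map_pow, pow_orderOf_eq_one, map_one]
  exact commutatorElement_eq_one_iff_commute.mp
    (key n (Subgroup.upperCentralSeries_mono G n.le_succ hx y))

/-- A subgroup containing a Sylow `p`-subgroup and all `p'`-elements is the whole group. -/
theorem Subgroup.eq_top_of_sylow_le_of_forall_not_dvd_orderOf {G : Type*} [Group G] [Finite G]
    {p : ℕ} [Fact p.Prime] (P : Sylow p G) {H : Subgroup G} (hP : ↑P ≤ H)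
    (hH : ∀ y : G, ¬ p ∣ orderOf y → y ∈ H) : H = ⊤ := by
  rw [← Subgroup.index_eq_one, Nat.eq_one_iff_not_exists_prime_dvd]
  intro q hq hdvd
  have : Fact q.Prime := ⟨hq⟩
  by_cases hqp : q = p
  · subst hqp
    exact P.not_dvd_index (hdvd.trans (Subgroup.index_dvd_of_le hP))
  · let Q : Sylow q G := default
    refine Q.not_dvd_index (hdvd.trans (Subgroup.index_dvd_of_le fun y hy => hH y fun hpy => ?_))
    obtain ⟨k, hk⟩ := IsPGroup.iff_orderOf.mp Q.2 ⟨y, hy⟩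
    rw [Subgroup.orderOf_mk] at hk
    rw [hk] at hpy
    exact hqp ((Nat.prime_dvd_prime_iff_eq Fact.out hq).mp
      (Nat.Prime.dvd_of_dvd_pow Fact.out hpy)).symm

/-- In a finite group with trivial centre, a `p`-element commuting with all `p'`-elements is
trivial. -/
theorem eq_one_of_center_eq_bot_of_forall_commute {G : Type*} [Group G] [Finite G]
    {p : ℕ} [Fact p.Prime] (hG : Subgroup.center G = ⊥) {x : G} {k : ℕ} (hx : x ^ p ^ k = 1)
    (h : ∀ y : G, ¬ p ∣ orderOf y → Commute x y) : x = 1 := by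
  by_contra hx1
  have hz : IsPGroup p (Subgroup.zpowers x) := by
    rintro ⟨_, j, rfl⟩
    refine ⟨k, Subtype.ext ?_⟩
    change (x ^ j) ^ p ^ k = 1
    rw [← zpow_natCast, ← zpow_mul, mul_comm, zpow_mul, zpow_natCast, hx, one_zpow]
  obtain ⟨P, hP⟩ := hz.exists_le_sylow
  let C : Subgroup G := Subgroup.centralizer {y | ¬ p ∣ orderOf y}
  have hC (z : G) : z ∈ C ↔ ∀ y : G, ¬ p ∣ orderOf y → Commute z y :=
    ⟨fun hz y hy => (Subgroup.mem_centralizer_iff.mp hz y hy).symm,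
      fun hz => Subgroup.mem_centralizer_iff.mpr fun y hy => (hz y hy).symm⟩
  have : C.Normal := ⟨fun z hz g => (hC _).mpr fun y hy => by
    have hord : orderOf (g⁻¹ * y * g) = orderOf y := by
      simpa using orderOf_injective (MulAut.conj g⁻¹).toMonoidHom (MulAut.conj g⁻¹).injective y
    have := (hC z).mp hz (g⁻¹ * y * g) (by rwa [hord])
    rw [← Commute.conj_iff g] at this
    simpa [mul_assoc] using this⟩
  have : Group.IsNilpotent P := P.2.isNilpotent
  obtain ⟨⟨z, hzP⟩, hzC, hz1, hzc⟩ :=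
    exists_ne_one_mem_center_of_mem_normal (C.subgroupOf P)
      (x := ⟨x, hP (Subgroup.mem_zpowers x)⟩) ((hC x).mpr h) (by simpa using hx1)
  have htop : Subgroup.centralizer {z} = ⊤ := by
    refine Subgroup.eq_top_of_sylow_le_of_forall_not_dvd_orderOf P (fun s hs => ?_) fun y hy => ?_
    · rw [Subgroup.mem_centralizer_singleton_iff]
      exact congrArg Subtype.val (Subgroup.mem_center_iff.mp hzc ⟨s, hs⟩)
    · rw [Subgroup.mem_centralizer_singleton_iff]
      exact ((hC z).mp hzC y hy).symm
  have hzG : z ∈ Subgroup.center G := Subgroup.mem_center_iff.mpr fun g =>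
    Subgroup.mem_centralizer_singleton_iff.mp (htop ▸ Subgroup.mem_top g)
  rw [hG, Subgroup.mem_bot] at hzG
  exact hz1 (Subtype.ext hzG)

/-- Every `p'`-element of a quotient of a finite group is a power of the image of a
`p'`-element. -/
theorem QuotientGroup.exists_pow_mk_eq_of_not_dvd_orderOf {G : Type*} [Group G] [Finite G]
    {p : ℕ} (hp : p.Prime) (N : Subgroup G) [N.Normal] (y : G ⧸ N) (hy : ¬ p ∣ orderOf y) :
    ∃ (g : G) (m : ℕ), ¬ p ∣ orderOf g ∧ (g : G ⧸ N) ^ m = y := by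
  obtain ⟨g, rfl⟩ := QuotientGroup.mk_surjective y
  obtain ⟨a, r, hr, hg⟩ := Nat.exists_eq_pow_mul_and_not_dvd (orderOf_pos g).ne' p hp.ne_one
  have hcop : (p ^ a).Coprime (orderOf (g : G ⧸ N)) :=
    ((Nat.Prime.coprime_iff_not_dvd hp).mpr hy).pow_left a
  obtain ⟨m, hm⟩ := exists_pow_eq_self_of_coprime hcop
  refine ⟨g ^ p ^ a, m, fun h => hr (h.trans (orderOf_dvd_of_pow_eq_one ?_)), by simpa using hm⟩
  rw [← pow_mul, ← hg, pow_orderOf_eq_one]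

/-- A p-element x of a finite group G lies in Z_∞(G) iff x commutes with every
p'-element of G. -/
theorem stmt_1 {G : Type*} [Group G] [Finite G] (p : ℕ) (hp : p.Prime)
    (x : G) (hx : ∃ k, orderOf x = p ^ k) :
    x ∈ ⨆ n, upperCentralSeries G n ↔
      ∀ y : G, ¬ p ∣ orderOf y → Commute x y := by
  have : Fact p.Prime := ⟨hp⟩
  obtain ⟨k, hk⟩ := hx
  change x ∈ ⨆ n, Subgroup.upperCentralSeries G n ↔ _
  have hmono : Monotone (Subgroup.upperCentralSeries G) := Subgroup.upperCentralSeries_mono G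
  constructor
  · intro h y hy
    obtain ⟨n, hn⟩ := (Subgroup.mem_iSup_of_directed hmono.directed_le).mp h
    refine commute_of_mem_upperCentralSeries_of_coprime hn ?_
    rw [hk]
    exact ((Nat.Prime.coprime_iff_not_dvd hp).mpr hy).pow_left k
  · intro h
    obtain ⟨n, hn⟩ := WellFoundedGT.monotone_chain_condition ⟨Subgroup.upperCentralSeries G, hmono⟩
    refine Subgroup.mem_iSup_of_mem n ((QuotientGroup.eq_one_iff x).mp ?_)
    refine eq_one_of_center_eq_bot_of_forall_commute (p := p) (k := k) ?_ ?_ fun y hy => ?_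
    · refine (Subgroup.eq_bot_iff_forall _).mpr fun z hz => ?_
      obtain ⟨g, rfl⟩ := QuotientGroup.mk_surjective z
      rw [QuotientGroup.eq_one_iff]
      refine (hn (n + 1) n.le_succ).ge ?_
      change g ∈ Subgroup.upperCentralSeriesStep (Subgroup.upperCentralSeries G n)
      rwa [Subgroup.upperCentralSeriesStep_eq_comap_center]
    · rw [← QuotientGroup.mk_pow, ← hk, pow_orderOf_eq_one, QuotientGroup.mk_one]
    · obtain ⟨g, m, hg, rfl⟩ := QuotientGroup.exists_pow_mk_eq_of_not_dvd_orderOf hp _ y hy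
      exact ((h g hg).map (QuotientGroup.mk' _)).pow_right m
end

section
/- Let G be a finite group, N a normal subgroup of G, and p a prime. If p divides the order of N ∩ Z_∞(G), then p divides the order of N ∩ Z(G). -/
theorem isNilpotent_upperCentralSeries {G : Type*} [Group G] (n : ℕ) :
    Group.IsNilpotent ↥(Subgroup.upperCentralSeries G n) := by
  rw [Subgroup.nilpotent_iff_finite_ascending_central_series]
  refine ⟨n, fun k => (Subgroup.upperCentralSeries G k).subgroupOf
    (Subgroup.upperCentralSeries G n), ⟨?_, fun x k hx g => ?_⟩, Subgroup.subgroupOf_self _⟩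
  · simp
  · exact Subgroup.mem_upperCentralSeries_succ_iff.mp hx g

/-- In a finite nilpotent group, the elements of `p`-power order are closed under products. -/
theorem exists_orderOf_mul_eq_prime_pow {H : Type*} [Group H] [Finite H] [Group.IsNilpotent H]
    {p : ℕ} [hp : Fact p.Prime] {x y : H} (hx : orderOf x = p) (hy : orderOf y = p) :
    ∃ k, orderOf (x * y) = p ^ k := by
  have mem_of_orderOf (P : Sylow p H) {z : H} (hz : orderOf z = p) : z ∈ P := by
    have hP : (P : Subgroup H).Normal :=
      have sylow_normal : Group.IsNilpotent H ↔
          ∀ (q : ℕ) (_ : Fact q.Prime) (Q : Sylow q H), (Q : Subgroup H).Normal :=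
        Group.isNilpotent_of_finite_tfae.out 0 3
      sylow_normal.mp ‹_› p hp P
    have := Sylow.unique_of_normal P hP
    have hz' : IsPGroup p (Subgroup.zpowers z) :=
      IsPGroup.of_card (n := 1) (by rw [Nat.card_zpowers, hz, pow_one])
    obtain ⟨Q, hQ⟩ := hz'.exists_le_sylow
    rw [Subsingleton.elim P Q]
    exact hQ (Subgroup.mem_zpowers z)
  let P : Sylow p H := default
  obtain ⟨k, hk⟩ := IsPGroup.iff_orderOf.mp P.isPGroup'
    ⟨x * y, mul_mem (mem_of_orderOf P hx) (mem_of_orderOf P hy)⟩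
  exact ⟨k, by simpa only [Subgroup.orderOf_mk] using hk⟩

/-- If a prime p divides |N ∩ Z_∞(G)|, then p divides |N ∩ Z(G)|. -/
theorem stmt_2 {G : Type*} [Group G] [Finite G] (N : Subgroup G) (hN : N.Normal)
    (p : ℕ) (hp : p.Prime)
    (h : p ∣ Nat.card ↥(N ⊓ ⨆ n, upperCentralSeries G n)) :
    p ∣ Nat.card ↥(N ⊓ Subgroup.center G) := by
  classical
  have : Fact p.Prime := ⟨hp⟩
  have hex : ∃ n, ∃ x ∈ N, x ∈ Subgroup.upperCentralSeries G n ∧ orderOf x = p := by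
    obtain ⟨⟨x, hxN, hxZ⟩, hx⟩ := exists_prime_orderOf_dvd_card' p h
    obtain ⟨n, hn⟩ := (Subgroup.mem_iSup_of_directed
      (Subgroup.upperCentralSeries_mono G).directed_le).mp hxZ
    exact ⟨n, x, hxN, hn, (Subgroup.orderOf_mk _ _).symm.trans hx⟩
  obtain ⟨x, hxN, hxZ, hx⟩ := Nat.find_spec hex
  have hmin {m : ℕ} := Nat.find_min hex (m := m)
  generalize Nat.find hex = n at hxZ hmin
  cases n with
  | zero =>
    rw [Subgroup.upperCentralSeries_zero, Subgroup.mem_bot] at hxZ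
    rw [hxZ, orderOf_one] at hx
    exact absurd hx.symm hp.ne_one
  | succ m =>
    have hcenter : x ∈ Subgroup.center G := by
      refine Subgroup.mem_center_iff.mpr fun g => ?_
      have hcZ := Subgroup.mem_upperCentralSeries_succ_iff.mp hxZ g
      have hcN : x * g * x⁻¹ * g⁻¹ ∈ N := by
        simpa only [mul_assoc] using N.mul_mem hxN (hN.conj_mem _ (N.inv_mem hxN) g)
      have := isNilpotent_upperCentralSeries (G := G) (m + 1)
      have hyZ : g * x⁻¹ * g⁻¹ ∈ Subgroup.upperCentralSeries G (m + 1) :=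
        Subgroup.Normal.conj_mem inferInstance _ (inv_mem hxZ) g
      have hy : orderOf (g * x⁻¹ * g⁻¹) = p := by
        rw [← MulAut.conj_apply, MulEquiv.orderOf_eq, orderOf_inv, hx]
      obtain ⟨k, hk⟩ := exists_orderOf_mul_eq_prime_pow (p := p)
        (x := (⟨x, hxZ⟩ : Subgroup.upperCentralSeries G (m + 1))) (y := ⟨_, hyZ⟩)
        (by rwa [Subgroup.orderOf_mk]) (by rwa [Subgroup.orderOf_mk])
      rw [MulMemClass.mk_mul_mk, Subgroup.orderOf_mk] at hk
      simp only [← mul_assoc] at hk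
      cases k with
      | zero =>
        rw [pow_zero, orderOf_eq_one_iff, mul_inv_eq_one, mul_inv_eq_iff_eq_mul] at hk
        exact hk.symm
      | succ k =>
        refine (hmin m.lt_succ_self ⟨_, N.pow_mem hcN (p ^ k), pow_mem hcZ (p ^ k), ?_⟩).elim
        rw [orderOf_pow_of_dvd (pow_ne_zero k hp.ne_zero) (hk ▸ pow_dvd_pow p k.le_succ), hk,
          pow_succ, Nat.mul_div_cancel_left _ (pow_pos hp.pos k)]
    rw [← hx]
    exact Subgroup.orderOf_dvd_natCard _ ⟨hxN, hcenter⟩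
end

section
/- Let G be a finite group, N a normal subgroup of G, and p a prime. Then the p-part of the cardinality of S_p^G(N) equals the p-part of the order of N ∩ Z_∞(G); that is, |S_p^G(N)|_p = |N ∩ Z_∞(G)|_p. -/
section

open Subgroup
open scoped commutatorElement

/-- The elements of `N` whose conjugacy class in `G` has size a power of `p`. -/
def primePowerClassSet {G : Type*} [Group G] (p : ℕ) (N : Subgroup G) : Set G :=
  {g | g ∈ N ∧ ∃ k, (centralizer {g}).index = p ^ k}

/-- The hypercentre of a group. -/
def hypercenter (G : Type*) [Group G] : Subgroup G :=
  ⨆ n, Subgroup.upperCentralSeries G n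

theorem mem_hypercenter_iff {G : Type*} [Group G] {x : G} :
    x ∈ hypercenter G ↔ ∃ n, x ∈ Subgroup.upperCentralSeries G n :=
  mem_iSup_of_directed (Subgroup.upperCentralSeries_mono G).directed_le

theorem comap_upperCentralSeries_quotient_le {G : Type*} [Group G] (Z : Subgroup G) [Z.Normal]
    (hZ : Z ≤ center G) (n : ℕ) :
    (Subgroup.upperCentralSeries (G ⧸ Z) n).comap (QuotientGroup.mk' Z) ≤
      Subgroup.upperCentralSeries G (n + 1) := by
  induction n with
  | zero =>
    intro x hx
    rw [zero_add, Subgroup.upperCentralSeries_one]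
    apply hZ
    simpa using hx
  | succ n ih =>
    intro x hx y
    refine ih ?_
    rw [mem_comap, map_commutatorElement]
    exact hx _

theorem comap_hypercenter_quotient {G : Type*} [Group G] (Z : Subgroup G) [Z.Normal]
    (hZ : Z ≤ center G) :
    (hypercenter (G ⧸ Z)).comap (QuotientGroup.mk' Z) = hypercenter G := by
  ext x
  rw [mem_comap, mem_hypercenter_iff, mem_hypercenter_iff]
  constructor
  · rintro ⟨n, hn⟩
    exact ⟨n + 1, comap_upperCentralSeries_quotient_le Z hZ n hn⟩
  · rintro ⟨n, hn⟩
    exact ⟨n, Subgroup.upperCentralSeries.map (QuotientGroup.mk'_surjective Z) n (mem_map_of_mem _ hn)⟩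

theorem relIndex_centralizer_dvd_card {G : Type*} [Group G] (Z : Subgroup G) (hZ : Z ≤ center G)
    (g : G) (H : Subgroup G) (hH : ∀ h ∈ H, ⁅h, g⁆ ∈ Z) :
    (centralizer {g}).relIndex H ∣ Nat.card Z := by
  let f : H →* Z :=
    { toFun := fun h => ⟨⁅(h : G), g⁆, hH h h.2⟩
      map_one' := by ext; simp
      map_mul' := by
        rintro ⟨a, ha⟩ ⟨b, hb⟩
        ext
        have hc := mem_center_iff.1 (hZ (hH b hb)) a
        have key : ⁅a * b, g⁆ = a * ⁅b, g⁆ * g * a⁻¹ * g⁻¹ := by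
          simp [commutatorElement_def, mul_assoc]
        change ⁅a * b, g⁆ = ⁅a, g⁆ * ⁅b, g⁆
        have hc' := mem_center_iff.1 (hZ (hH b hb)) ⁅a, g⁆
        rw [key, hc, hc']
        simp [commutatorElement_def, mul_assoc] }
  have hf : f.ker = (centralizer {g}).subgroupOf H := by
    ext ⟨h, hh⟩
    rw [MonoidHom.mem_ker, mem_subgroupOf, mem_centralizer_singleton_iff]
    rw [← commutatorElement_eq_one_iff_mul_comm]
    exact Subtype.ext_iff
  rw [relIndex, ← hf, index_ker]
  exact card_subgroup_dvd_card _

theorem exists_index_centralizer_mk_eq_pow_iff {G : Type*} [Group G] {p : ℕ} (hp : p.Prime)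
    (Z : Subgroup G) [Z.Normal] (hZ : Z ≤ center G) (hcard : Nat.card Z = p) (g : G) :
    (∃ k, (centralizer {(g : G ⧸ Z)}).index = p ^ k) ↔
      ∃ k, (centralizer {g}).index = p ^ k := by
  set H := (centralizer {(g : G ⧸ Z)}).comap (QuotientGroup.mk' Z) with hHdef
  have hH : H.index = (centralizer {(g : G ⧸ Z)}).index :=
    index_comap_of_surjective _ (QuotientGroup.mk'_surjective Z)
  have hmem : ∀ h, h ∈ H ↔ ⁅h, g⁆ ∈ Z := by
    intro h
    rw [hHdef, mem_comap, mem_centralizer_singleton_iff,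
      ← commutatorElement_eq_one_iff_mul_comm, ← QuotientGroup.eq_one_iff]
    exact Iff.rfl
  have hle : centralizer {g} ≤ H := by
    intro h hh
    rw [mem_centralizer_singleton_iff, ← commutatorElement_eq_one_iff_mul_comm] at hh
    rw [hmem, hh]
    exact one_mem Z
  have hmul := relIndex_mul_index hle
  have hdvd := relIndex_centralizer_dvd_card Z hZ g H fun h hh => (hmem h).1 hh
  rw [hcard] at hdvd
  rw [← hH]
  constructor
  · rintro ⟨k, hk⟩
    obtain ⟨j, -, hj⟩ := (Nat.dvd_prime_pow hp (m := 1)).1 (by simpa using hdvd)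
    exact ⟨j + k, by rw [← hmul, hj, hk, pow_add]⟩
  · rintro ⟨k, hk⟩
    obtain ⟨j, -, hj⟩ := (Nat.dvd_prime_pow hp (m := k)).1 (hk ▸ Dvd.intro_left _ hmul)
    exact ⟨j, hj⟩

theorem mk_mem_map_mk'_iff {G : Type*} [Group G] {Z N : Subgroup G} [Z.Normal] (hZN : Z ≤ N)
    (g : G) : (g : G ⧸ Z) ∈ N.map (QuotientGroup.mk' Z) ↔ g ∈ N := by
  have h : (N.map (QuotientGroup.mk' Z)).comap (QuotientGroup.mk' Z) = N :=
    comap_map_eq_self (by simpa using hZN)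
  exact SetLike.ext_iff.1 h g

theorem card_primePowerClassSet_eq_mul {G : Type*} [Group G] {p : ℕ} (hp : p.Prime)
    (Z N : Subgroup G) [Z.Normal] (hZ : Z ≤ center G) (hZN : Z ≤ N) (hcard : Nat.card Z = p) :
    Nat.card (primePowerClassSet p N) =
      p * Nat.card (primePowerClassSet p (N.map (QuotientGroup.mk' Z))) := by
  have h : primePowerClassSet p N =
      QuotientGroup.mk ⁻¹' primePowerClassSet p (N.map (QuotientGroup.mk' Z)) := by
    ext g
    exact (and_congr (mk_mem_map_mk'_iff hZN g)
      (exists_index_centralizer_mk_eq_pow_iff hp Z hZ hcard g)).symm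
  rw [h, QuotientGroup.card_preimage_mk, hcard]

theorem card_inf_hypercenter_eq_mul {G : Type*} [Group G]
    (Z N : Subgroup G) [Z.Normal] (hZ : Z ≤ center G) (hZN : Z ≤ N) :
    Nat.card ↥(N ⊓ hypercenter G) =
      Nat.card Z * Nat.card ↥(N.map (QuotientGroup.mk' Z) ⊓ hypercenter (G ⧸ Z)) := by
  have h : ((N ⊓ hypercenter G : Subgroup G) : Set G) = QuotientGroup.mk ⁻¹'
      ((N.map (QuotientGroup.mk' Z) ⊓ hypercenter (G ⧸ Z) : Subgroup (G ⧸ Z)) : Set (G ⧸ Z)) := by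
    ext g
    exact (and_congr (mk_mem_map_mk'_iff hZN g)
      (SetLike.ext_iff.1 (comap_hypercenter_quotient Z hZ) g)).symm
  have hc := QuotientGroup.card_preimage_mk Z
    ((N.map (QuotientGroup.mk' Z) ⊓ hypercenter (G ⧸ Z) : Subgroup (G ⧸ Z)) : Set (G ⧸ Z))
  rw [← h] at hc
  exact hc

theorem index_centralizer_conj {G : Type*} [Group G] (x g : G) :
    (centralizer {x * g * x⁻¹}).index = (centralizer {g}).index := by
  have h : (centralizer {x * g * x⁻¹}).comap (MulAut.conj x).toMonoidHom = centralizer {g} := by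
    ext y
    rw [mem_comap, mem_centralizer_singleton_iff, mem_centralizer_singleton_iff]
    change x * y * x⁻¹ * (x * g * x⁻¹) = x * g * x⁻¹ * (x * y * x⁻¹) ↔ _
    rw [_root_.conj_mul, _root_.conj_mul, mul_left_inj, mul_right_inj]
  rw [← h, index_comap_of_surjective _ (MulAut.conj x).surjective]

theorem conj_mem_primePowerClassSet {G : Type*} [Group G] {p : ℕ} {N : Subgroup G}
    (hN : N.Normal) (x : G) {g : G} (hg : g ∈ primePowerClassSet p N) :
    x * g * x⁻¹ ∈ primePowerClassSet p N :=
  ⟨hN.conj_mem g hg.1 x, by rw [index_centralizer_conj]; exact hg.2⟩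

theorem mem_center_of_sylow_le_centralizer {G : Type*} [Group G] [Finite G] {p : ℕ}
    [hp : Fact p.Prime] (P : Sylow p G) {g : G} (hP : (P : Subgroup G) ≤ centralizer {g})
    (hg : ∃ k, (centralizer {g}).index = p ^ k) : g ∈ center G := by
  obtain ⟨k, hk⟩ := hg
  have hk0 : k = 0 := by
    by_contra hne
    apply P.not_dvd_index
    exact ((dvd_pow_self p hne).trans hk.symm.dvd).trans (index_dvd_of_le hP)
  rw [hk0, pow_zero, index_eq_one] at hk
  rw [mem_center_iff]
  intro y
  exact mem_centralizer_singleton_iff.1 (hk ▸ mem_top y)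

theorem card_primePowerClassSet_modEq {G : Type*} [Group G] [Finite G] {p : ℕ} (hp : p.Prime)
    (N : Subgroup G) (hN : N.Normal) :
    Nat.card (primePowerClassSet p N) ≡ Nat.card ↥(N ⊓ center G) [MOD p] := by
  have : Fact p.Prime := ⟨hp⟩
  obtain ⟨P⟩ : Nonempty (Sylow p G) := inferInstance
  let _ : MulAction P (primePowerClassSet p N) :=
    { smul := fun x g => ⟨x * g * (x : G)⁻¹, conj_mem_primePowerClassSet hN x g.2⟩
      one_smul := fun g => Subtype.ext (show (1 : G) * g * (1 : G)⁻¹ = g by simp)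
      mul_smul := fun x y g => Subtype.ext
        (show ((x : G) * y) * g * ((x : G) * y)⁻¹ = x * (y * g * (y : G)⁻¹) * (x : G)⁻¹ by
          simp [mul_assoc]) }
  refine (P.2.card_modEq_card_fixedPoints (primePowerClassSet p N)).trans ?_
  have hfix : ∀ g : primePowerClassSet p N,
      g ∈ MulAction.fixedPoints P (primePowerClassSet p N) ↔ (g : G) ∈ center G := by
    rintro ⟨g, hg⟩
    have hsmul : ∀ x : P, x • (⟨g, hg⟩ : primePowerClassSet p N) = ⟨g, hg⟩ ↔
        (x : G) * g = g * x := fun x => by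
      rw [← mul_inv_eq_iff_eq_mul]
      exact Subtype.ext_iff
    constructor
    · intro h
      refine mem_center_of_sylow_le_centralizer P (fun x hx => ?_) hg.2
      exact mem_centralizer_singleton_iff.2 ((hsmul ⟨x, hx⟩).1 (h ⟨x, hx⟩))
    · intro h x
      exact (hsmul x).2 (mem_center_iff.1 h x)
  refine congrArg (· % p) (Nat.card_congr ?_)
  refine
    { toFun := fun g => ⟨g.1.1, g.1.2.1, (hfix g.1).1 g.2⟩
      invFun := fun g => ⟨⟨g.1, g.2.1, 0, ?_⟩, (hfix _).2 g.2.2⟩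
      left_inv := fun _ => rfl
      right_inv := fun _ => rfl }
  rw [pow_zero, index_eq_one, eq_top_iff]
  intro y _
  exact mem_centralizer_singleton_iff.2 (mem_center_iff.1 g.2.2 y)

theorem commutatorElement_pow_left_of_mem_center {G : Type*} [Group G] {x y : G}
    (h : ⁅x, y⁆ ∈ center G) (n : ℕ) : ⁅x ^ n, y⁆ = ⁅x, y⁆ ^ n := by
  have hx : x = ⁅x, y⁆ * (y * x * y⁻¹) := by simp [commutatorElement_def, mul_assoc]
  have hc : Commute ⁅x, y⁆ (y * x * y⁻¹) := (mem_center_iff.1 h _).symm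
  have hpow : x ^ n = ⁅x, y⁆ ^ n * (y * x ^ n * y⁻¹) := by
    conv_lhs => rw [hx, hc.mul_pow, conj_pow]
  have := mul_inv_eq_of_eq_mul hpow
  rw [← this]
  simp [commutatorElement_def, mul_assoc]

theorem eq_one_of_mem_upperCentralSeries_of_pow_eq_one {G : Type*} [Group G] [Finite G] {p : ℕ}
    (hp : p.Prime) (N : Subgroup G) (hN : N.Normal) (hcard : ¬ p ∣ Nat.card ↥(N ⊓ center G))
    (n : ℕ) : ∀ x ∈ N, x ∈ Subgroup.upperCentralSeries G n → x ^ p = 1 → x = 1 := by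
  have : Fact p.Prime := ⟨hp⟩
  have horder : ∀ {K : Subgroup G} {x : G}, ¬ p ∣ Nat.card K → x ∈ K → x ^ p = 1 → x = 1 := by
    intro K x hK hx hxp
    by_contra hne
    exact hK (orderOf_eq_prime hxp hne ▸ K.orderOf_dvd_natCard hx)
  have hcauchy : ∀ {K : Subgroup G}, (∀ x ∈ K, x ^ p = 1 → x = 1) → ¬ p ∣ Nat.card K := by
    intro K h hdvd
    obtain ⟨x, hx⟩ := exists_prime_orderOf_dvd_card' (G := K) p hdvd
    have hx1 : (x : G) = 1 := h x x.2 (by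
      rw [← hx, ← orderOf_coe, pow_orderOf_eq_one])
    rw [← orderOf_coe, hx1, orderOf_one] at hx
    exact hp.one_lt.ne hx
  induction n with
  | zero => intro x _ hx _; simpa using hx
  | succ n ih =>
    intro x hxN hx hxp
    cases n with
    | zero =>
      rw [zero_add, Subgroup.upperCentralSeries_one] at hx
      exact horder hcard (mem_inf.2 ⟨hxN, hx⟩) hxp
    | succ m =>
      refine ih x hxN (fun y => ?_) hxp
      set A := Subgroup.upperCentralSeries G m
      have hcN : ⁅x, y⁆ ∈ N := by
        rw [commutatorElement_def, mul_assoc, mul_assoc, ← mul_assoc y]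
        exact mul_mem hxN (hN.conj_mem _ (inv_mem hxN) y)
      have hcZ : ⁅x, y⁆ ∈ Subgroup.upperCentralSeries G (m + 1) := hx y
      have hcenter : ⁅(x : G ⧸ A), (y : G ⧸ A)⁆ ∈ center (G ⧸ A) := by
        rw [mem_center_iff]
        intro z
        obtain ⟨z, rfl⟩ := QuotientGroup.mk_surjective z
        symm
        rw [← commutatorElement_eq_one_iff_mul_comm]
        exact (QuotientGroup.eq_one_iff _).2 (hcZ z)
      have hpowA : ⁅x, y⁆ ^ p ∈ A := by
        rw [← QuotientGroup.eq_one_iff]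
        have h := commutatorElement_pow_left_of_mem_center hcenter p
        rw [← QuotientGroup.mk_pow, hxp, QuotientGroup.mk_one, commutatorElement_one_left] at h
        exact h.symm
      have hnd : ¬ p ∣ Nat.card ↥(N ⊓ Subgroup.upperCentralSeries G (m + 1)) :=
        hcauchy fun z hz => ih z hz.1 hz.2
      have hcop : (orderOf ⁅x, y⁆).Coprime p := by
        refine (((Nat.Prime.coprime_iff_not_dvd hp).2 fun h => hnd (h.trans ?_))).symm
        exact orderOf_dvd_natCard _ (mem_inf.2 ⟨hcN, hcZ⟩)
      obtain ⟨j, hj⟩ := exists_pow_eq_self_of_coprime hcop.symm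
      rw [← hj]
      exact pow_mem hpowA j

theorem not_dvd_card_inf_hypercenter {G : Type*} [Group G] [Finite G] {p : ℕ}
    (hp : p.Prime) (N : Subgroup G) (hN : N.Normal) (hcard : ¬ p ∣ Nat.card ↥(N ⊓ center G)) :
    ¬ p ∣ Nat.card ↥(N ⊓ hypercenter G) := by
  have : Fact p.Prime := ⟨hp⟩
  intro hdvd
  obtain ⟨⟨x, hxm⟩, hx⟩ := exists_prime_orderOf_dvd_card' p hdvd
  rw [orderOf_mk] at hx
  obtain ⟨hxN, hxZ⟩ := mem_inf.1 hxm
  obtain ⟨n, hn⟩ := mem_hypercenter_iff.1 hxZ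
  have hx1 := eq_one_of_mem_upperCentralSeries_of_pow_eq_one hp N hN hcard n x hxN hn
    (hx ▸ pow_orderOf_eq_one x)
  rw [hx1, orderOf_one] at hx
  exact hp.one_lt.ne hx

theorem factorization_card_primePowerClassSet {p : ℕ} (hp : p.Prime) (n : ℕ) :
    ∀ {G : Type*} [Group G] [Finite G] (N : Subgroup G), N.Normal → Nat.card G = n →
      (Nat.card (primePowerClassSet p N)).factorization p =
        (Nat.card ↥(N ⊓ hypercenter G)).factorization p := by
  have : Fact p.Prime := ⟨hp⟩
  induction n using Nat.strong_induction_on with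
  | _ n ih =>
  intro G _ _ N hN hn
  by_cases hdvd : p ∣ Nat.card ↥(N ⊓ center G)
  · obtain ⟨⟨z, hzm⟩, hz⟩ := exists_prime_orderOf_dvd_card' p hdvd
    rw [orderOf_mk] at hz
    obtain ⟨hzN, hzc⟩ := mem_inf.1 hzm
    have hZ : zpowers z ≤ center G := zpowers_le.2 hzc
    have hZN : zpowers z ≤ N := zpowers_le.2 hzN
    have hcard : Nat.card (zpowers z) = p := by rw [Nat.card_zpowers, hz]
    have : (zpowers z).Normal := ⟨fun a ha g => by
      rwa [mem_center_iff.1 (hZ ha) g, mul_inv_cancel_right]⟩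
    have hlt : Nat.card (G ⧸ zpowers z) < n := by
      have h := card_eq_card_quotient_mul_card_subgroup (zpowers z)
      rw [hcard, hn] at h
      rw [h]
      exact lt_mul_of_one_lt_right Nat.card_pos hp.one_lt
    have hrec := ih _ hlt (N.map (QuotientGroup.mk' (zpowers z)))
      (hN.map _ (QuotientGroup.mk'_surjective _)) rfl
    have hne : Nat.card (primePowerClassSet p (N.map (QuotientGroup.mk' (zpowers z)))) ≠ 0 := by
      have : Nonempty (primePowerClassSet p (N.map (QuotientGroup.mk' (zpowers z)))) :=
        ⟨⟨1, one_mem _, 0, by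
          rw [pow_zero, index_eq_one, eq_top_iff]
          intro y _
          exact mem_centralizer_singleton_iff.2 (by simp)⟩⟩
      exact Nat.card_pos.ne'
    rw [card_primePowerClassSet_eq_mul hp (zpowers z) N hZ hZN hcard,
      card_inf_hypercenter_eq_mul (zpowers z) N hZ hZN, hcard,
      Nat.factorization_mul hp.ne_zero hne, Nat.factorization_mul hp.ne_zero Nat.card_pos.ne',
      Finsupp.add_apply, Finsupp.add_apply, hrec]
  · rw [Nat.factorization_eq_zero_of_not_dvd (not_dvd_card_inf_hypercenter hp N hN hdvd),
      Nat.factorization_eq_zero_of_not_dvd]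
    rwa [(card_primePowerClassSet_modEq hp N hN).dvd_iff dvd_rfl]

end

/-- |S_p^G(N)|_p = |N ∩ Z_∞(G)|_p. -/
theorem stmt_3 {G : Type*} [Group G] [Finite G] (N : Subgroup G) (hN : N.Normal)
    (p : ℕ) (hp : p.Prime) :
    p ^ (Nat.card {g : G | g ∈ N ∧ ∃ k, (Subgroup.centralizer {g}).index = p ^ k}).factorization p
      = p ^ (Nat.card ↥(N ⊓ ⨆ n, upperCentralSeries G n)).factorization p :=
  congrArg (p ^ ·) (factorization_card_primePowerClassSet hp (Nat.card G) N hN rfl)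
end

section
/- Let G be a finite group, N a normal subgroup of G, and p a prime. Then a Sylow p-subgroup of N is contained in the hypercentre Z_∞(G) if and only if |S_p^G(N)|_p = |N|_p. -/
section Hypercentre

universe u

variable {G : Type u} [Group G]

/-- The elements of `N` whose `G`-conjugacy class has size a power of `p`. -/
def primePowerIndexElements (N : Subgroup G) (p : ℕ) : Set G :=
  {g : G | g ∈ N ∧ ∃ k, (Subgroup.centralizer {g}).index = p ^ k}

/-- Every `p`-element of `N` lies in the hypercentre of `G`. -/
def PElementsHypercentral (N : Subgroup G) (p : ℕ) : Prop :=
  ∀ x ∈ N, (∃ k, x ^ p ^ k = 1) → x ∈ ⨆ n, Subgroup.upperCentralSeries G n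

theorem mem_iSup_upperCentralSeries_iff {x : G} :
    x ∈ ⨆ n, Subgroup.upperCentralSeries G n ↔ ∃ n, x ∈ Subgroup.upperCentralSeries G n :=
  Subgroup.mem_iSup_of_directed (Subgroup.upperCentralSeries_mono G).directed_le

theorem mk_mem_upperCentralSeries (A : Subgroup G) [A.Normal] (n : ℕ) {x : G}
    (hx : x ∈ Subgroup.upperCentralSeries G n) :
    (x : G ⧸ A) ∈ Subgroup.upperCentralSeries (G ⧸ A) n := by
  induction n generalizing x with
  | zero => simp_all
  | succ n ih =>
    rw [Subgroup.mem_upperCentralSeries_succ_iff] at hx ⊢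
    intro y
    obtain ⟨y, rfl⟩ := QuotientGroup.mk_surjective y
    exact ih (hx y)

theorem mem_upperCentralSeries_succ_of_mk_mem (A : Subgroup G) [A.Normal]
    (hA : A ≤ Subgroup.center G) (n : ℕ) {x : G}
    (hx : (x : G ⧸ A) ∈ Subgroup.upperCentralSeries (G ⧸ A) n) :
    x ∈ Subgroup.upperCentralSeries G (n + 1) := by
  induction n generalizing x with
  | zero =>
    have hx' : x ∈ A := by simpa using hx
    simpa using hA hx'
  | succ n ih =>
    rw [Subgroup.mem_upperCentralSeries_succ_iff] at hx ⊢
    exact fun y => ih (hx y)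

theorem mk_mem_hypercentre_iff (A : Subgroup G) [A.Normal] (hA : A ≤ Subgroup.center G) {x : G} :
    (x : G ⧸ A) ∈ ⨆ n, Subgroup.upperCentralSeries (G ⧸ A) n ↔
      x ∈ ⨆ n, Subgroup.upperCentralSeries G n := by
  rw [mem_iSup_upperCentralSeries_iff, mem_iSup_upperCentralSeries_iff]
  exact ⟨fun ⟨n, h⟩ => ⟨n + 1, mem_upperCentralSeries_succ_of_mk_mem A hA n h⟩,
    fun ⟨n, h⟩ => ⟨n, mk_mem_upperCentralSeries A n h⟩⟩

theorem commutator_pow_mem (M : Subgroup G) [M.Normal] (x y : G)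
    (hc : ∀ z, x * y * x⁻¹ * y⁻¹ * z * (x * y * x⁻¹ * y⁻¹)⁻¹ * z⁻¹ ∈ M) (k : ℕ)
    (hk : x ^ k * y * (x ^ k)⁻¹ * y⁻¹ ∈ M) : (x * y * x⁻¹ * y⁻¹) ^ k ∈ M := by
  have key : ∀ j : ℕ, ((x ^ j * y * (x ^ j)⁻¹ : G) : G ⧸ M) =
      (((x * y * x⁻¹ * y⁻¹) ^ j * y : G) : G ⧸ M) := by
    intro j
    have hcomm : Commute ((x * y * x⁻¹ * y⁻¹ : G) : G ⧸ M) (x : G ⧸ M) := by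
      have := (QuotientGroup.eq_one_iff _).2 (hc x)
      simp only [QuotientGroup.mk_mul, QuotientGroup.mk_inv] at this ⊢
      exact mul_inv_eq_iff_eq_mul.1 (mul_inv_eq_one.1 this)
    induction j with
    | zero => simp
    | succ j ih =>
      have e : x ^ (j + 1) * y * (x ^ (j + 1))⁻¹ = x * (x ^ j * y * (x ^ j)⁻¹) * x⁻¹ := by
        rw [pow_succ']; group
      have hj := (hcomm.pow_left j).eq
      rw [e, QuotientGroup.mk_mul, QuotientGroup.mk_mul, ih, ← QuotientGroup.mk_mul,
        ← QuotientGroup.mk_mul, ← mul_assoc, QuotientGroup.mk_mul, QuotientGroup.mk_mul,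
        QuotientGroup.mk_mul, QuotientGroup.mk_pow, ← hj, pow_succ, ← QuotientGroup.mk_pow]
      simp only [← QuotientGroup.mk_mul]
      congr 1
      group
  have h1 := (QuotientGroup.eq_one_iff _).2 hk
  rw [← QuotientGroup.eq_one_iff]
  rw [QuotientGroup.mk_mul, key k, QuotientGroup.mk_mul] at h1
  simpa using h1

/-- If `N ⊓ Z(G)` has no `p`-torsion, then neither do the factors of the upper central series,
intersected with `N`. -/
theorem mem_upperCentralSeries_of_pow_mem (N : Subgroup G) (hN : N.Normal) (p : ℕ)
    (h : ∀ z ∈ N, z ∈ Subgroup.center G → z ^ p = 1 → z = 1) (n : ℕ) {x : G} (hxN : x ∈ N)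
    (hx : x ∈ Subgroup.upperCentralSeries G (n + 1))
    (hxp : x ^ p ∈ Subgroup.upperCentralSeries G n) :
    x ∈ Subgroup.upperCentralSeries G n := by
  induction n generalizing x with
  | zero =>
    have := h x hxN (by simpa using hx) (by simpa using hxp)
    simp [this]
  | succ n ih =>
    rw [Subgroup.mem_upperCentralSeries_succ_iff] at hx ⊢
    intro y
    have hc := hx y
    refine ih ?_ hc ?_
    · have := N.mul_mem hxN (hN.conj_mem _ (N.inv_mem hxN) y)
      rwa [show x * (y * x⁻¹ * y⁻¹) = x * y * x⁻¹ * y⁻¹ by group] at this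
    · exact commutator_pow_mem _ x y (Subgroup.mem_upperCentralSeries_succ_iff.1 hc) p
        (Subgroup.mem_upperCentralSeries_succ_iff.1 hxp y)

theorem eq_one_of_mem_hypercentre (N : Subgroup G) (hN : N.Normal) (p : ℕ)
    (h : ∀ z ∈ N, z ∈ Subgroup.center G → z ^ p = 1 → z = 1) {x : G} (hxN : x ∈ N)
    (hx : x ∈ ⨆ n, Subgroup.upperCentralSeries G n) (hxp : x ^ p = 1) : x = 1 := by
  obtain ⟨n, hn⟩ := mem_iSup_upperCentralSeries_iff.1 hx
  induction n with
  | zero => simpa using hn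
  | succ n ih =>
    exact ih (mem_upperCentralSeries_of_pow_mem N hN p h n hxN hn (hxp ▸ Subgroup.one_mem _))

/-- Conjugation action of a subgroup on the elements of prime power index. -/
@[reducible] def conjActionPrimePowerIndex (N : Subgroup G) (hN : N.Normal) (p : ℕ)
    (Q : Subgroup G) : MulAction Q (primePowerIndexElements N p) where
  smul h s := ⟨h * s * (h : G)⁻¹, hN.conj_mem _ s.2.1 h, by
    obtain ⟨k, hk⟩ := s.2.2
    refine ⟨k, ?_⟩
    rw [← hk, ← Subgroup.index_map_equiv (Subgroup.centralizer {(s : G)}) (MulAut.conj (h : G))]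
    congr 1
    ext x
    change _ ↔ x ∈ (Subgroup.centralizer {(s : G)}).map (MulAut.conj (h : G)).toMonoidHom
    rw [Subgroup.mem_map_equiv]
    simp only [Subgroup.mem_centralizer_singleton_iff, MulAut.conj_symm_apply]
    constructor
    · intro e
      have := congrArg (fun z => (h : G)⁻¹ * z * h) e
      simpa [mul_assoc] using this
    · intro e
      have := congrArg (fun z => (h : G) * z * (h : G)⁻¹) e
      simpa [mul_assoc] using this⟩
  one_smul s := Subtype.ext (by
    change ((1 : Q) : G) * s * ((1 : Q) : G)⁻¹ = s
    simp)
  mul_smul a b s := Subtype.ext (by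
    change ((a * b : Q) : G) * s * ((a * b : Q) : G)⁻¹ = a * (b * s * (b : G)⁻¹) * (a : G)⁻¹
    simp [mul_assoc])

theorem card_primePowerIndexElements_modEq [Finite G] (N : Subgroup G) (hN : N.Normal) (p : ℕ)
    (hp : p.Prime) :
    Nat.card (primePowerIndexElements N p) ≡ Nat.card ↥(N ⊓ Subgroup.center G) [MOD p] := by
  have : Fact p.Prime := ⟨hp⟩
  let Q : Sylow p G := default
  let _ := conjActionPrimePowerIndex N hN p (Q : Subgroup G)
  have smul_def : ∀ (h : (Q : Subgroup G)) (s : primePowerIndexElements N p),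
      ((h • s : primePowerIndexElements N p) : G) = h * s * (h : G)⁻¹ := fun _ _ => rfl
  have key := Q.isPGroup'.card_modEq_card_fixedPoints (primePowerIndexElements N p)
  rw [show Nat.card ↥(N ⊓ Subgroup.center G) =
    Nat.card (MulAction.fixedPoints (Q : Subgroup G) (primePowerIndexElements N p)) from ?_]
  · exact key
  symm
  refine Nat.card_congr ⟨fun s => ⟨s.1.1, s.1.2.1, ?_⟩, fun z => ⟨⟨z.1, z.2.1, 0, ?_⟩, ?_⟩,
    fun _ => rfl, fun _ => rfl⟩
  · obtain ⟨⟨s, hsN, k, hk⟩, hs⟩ := s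
    have hle : (Q : Subgroup G) ≤ Subgroup.centralizer {s} := by
      intro h hh
      have := congrArg Subtype.val (hs ⟨h, hh⟩)
      rw [smul_def] at this
      exact Subgroup.mem_centralizer_singleton_iff.2 (mul_inv_eq_iff_eq_mul.1 this)
    have hdvd := Subgroup.index_dvd_of_le hle
    have h0 : k = 0 := by
      by_contra hk0
      exact Q.not_dvd_index ((dvd_pow_self p hk0).trans (hk ▸ hdvd))
    subst h0
    rw [pow_zero, Subgroup.index_eq_one] at hk
    exact Subgroup.mem_center_iff.2 fun g =>
      Subgroup.mem_centralizer_singleton_iff.1 (hk ▸ Subgroup.mem_top g)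
  · rw [pow_zero, Subgroup.index_eq_one, eq_top_iff]
    intro g _
    exact Subgroup.mem_centralizer_singleton_iff.2 (Subgroup.mem_center_iff.1 z.2.2 g)
  · intro h
    refine Subtype.ext ?_
    rw [smul_def]
    exact mul_inv_eq_iff_eq_mul.2 (Subgroup.mem_center_iff.1 z.2.2 h)

theorem index_centralizer_mk_dvd (A : Subgroup G) [A.Normal] (g : G) :
    (Subgroup.centralizer {(g : G ⧸ A)}).index ∣ (Subgroup.centralizer {g}).index := by
  rw [← Subgroup.index_comap_of_surjective _ (QuotientGroup.mk'_surjective A)]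
  refine Subgroup.index_dvd_of_le fun h hh => ?_
  rw [Subgroup.mem_comap, Subgroup.mem_centralizer_singleton_iff]
  exact congrArg (QuotientGroup.mk (s := A)) (Subgroup.mem_centralizer_singleton_iff.1 hh)

theorem index_centralizer_dvd (A : Subgroup G) [A.Normal] (hA : A ≤ Subgroup.center G) (g : G) :
    (Subgroup.centralizer {g}).index ∣
      Nat.card A * (Subgroup.centralizer {(g : G ⧸ A)}).index := by
  rw [← Subgroup.index_comap_of_surjective _ (QuotientGroup.mk'_surjective A)]
  set H := (Subgroup.centralizer {(g : G ⧸ A)}).comap (QuotientGroup.mk' A) with hH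
  have hmem : ∀ h : H, (h : G) * g * (h : G)⁻¹ * g⁻¹ ∈ A := by
    intro h
    have := Subgroup.mem_centralizer_singleton_iff.1 (Subgroup.mem_comap.1 h.2)
    rw [← QuotientGroup.eq_one_iff]
    simp only [QuotientGroup.mk_mul, QuotientGroup.mk_inv]
    simp only [QuotientGroup.mk'_apply] at this
    rw [this]
    group
  let φ : H →* A := MonoidHom.mk' (fun h => ⟨(h : G) * g * (h : G)⁻¹ * g⁻¹, hmem h⟩) (by
    intro a b
    refine Subtype.ext ?_
    have hb := Subgroup.mem_center_iff.1 (hA (hmem b)) ((a : G) * g * (a : G)⁻¹ * g⁻¹)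
    have ha := Subgroup.mem_center_iff.1 (hA (hmem b)) (a : G)
    simp only [Subgroup.coe_mul]
    rw [hb]
    calc ((a : G) * b) * g * ((a : G) * b)⁻¹ * g⁻¹
        = (a * (b * g * (b : G)⁻¹ * g⁻¹)) * (g * (a : G)⁻¹ * g⁻¹) := by group
      _ = _ := by rw [ha]; group)
  have hle : Subgroup.centralizer {g} ≤ H := by
    intro h hh
    rw [hH, Subgroup.mem_comap, Subgroup.mem_centralizer_singleton_iff]
    exact congrArg (QuotientGroup.mk (s := A)) (Subgroup.mem_centralizer_singleton_iff.1 hh)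
  have hker : φ.ker = (Subgroup.centralizer {g}).subgroupOf H := by
    ext h
    rw [MonoidHom.mem_ker, Subgroup.mem_subgroupOf, Subgroup.mem_centralizer_singleton_iff,
      ← Subtype.coe_inj]
    change (h : G) * g * (h : G)⁻¹ * g⁻¹ = 1 ↔ _
    rw [mul_inv_eq_one, mul_inv_eq_iff_eq_mul]
  rw [← Subgroup.relIndex_mul_index hle]
  refine mul_dvd_mul_right ?_ _
  rw [Subgroup.relIndex, ← hker, Subgroup.index_ker]
  exact Subgroup.card_subgroup_dvd_card _

theorem preimage_primePowerIndexElements (N A : Subgroup G) [A.Normal] (hAN : A ≤ N)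
    (hA : A ≤ Subgroup.center G) (p : ℕ) (hp : p.Prime) (hcard : Nat.card A = p) :
    QuotientGroup.mk ⁻¹' primePowerIndexElements (N.map (QuotientGroup.mk' A)) p =
      primePowerIndexElements N p := by
  ext g
  have hmem : (g : G ⧸ A) ∈ N.map (QuotientGroup.mk' A) ↔ g ∈ N := by
    rw [← QuotientGroup.mk'_apply, ← Subgroup.mem_comap,
      Subgroup.comap_map_eq_self (by rwa [QuotientGroup.ker_mk'])]
  change ((g : G ⧸ A) ∈ _ ∧ _) ↔ (g ∈ N ∧ _)
  rw [hmem]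
  refine and_congr_right fun _ => ⟨?_, ?_⟩
  · rintro ⟨k, hk⟩
    have := index_centralizer_dvd A hA g
    rw [hcard, hk, ← pow_succ'] at this
    obtain ⟨m, -, hm⟩ := (Nat.dvd_prime_pow hp).1 this
    exact ⟨m, hm⟩
  · rintro ⟨k, hk⟩
    obtain ⟨m, -, hm⟩ := (Nat.dvd_prime_pow hp).1 (hk ▸ index_centralizer_mk_dvd A g)
    exact ⟨m, hm⟩

theorem card_preimage_mk (A : Subgroup G) (t : Set (G ⧸ A)) :
    Nat.card ↥((QuotientGroup.mk : G → G ⧸ A) ⁻¹' t) = Nat.card A * Nat.card t := by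
  rw [Nat.card_congr (QuotientGroup.preimageMkEquivSubgroupProdSet A t), Nat.card_prod]

theorem pElementsHypercentral_map_iff (N A : Subgroup G) [A.Normal]
    (hA : A ≤ Subgroup.center G) (p : ℕ) (hcard : Nat.card A = p) :
    PElementsHypercentral (N.map (QuotientGroup.mk' A)) p ↔ PElementsHypercentral N p := by
  constructor
  · rintro h x hx ⟨k, hk⟩
    rw [← mk_mem_hypercentre_iff A hA]
    refine h _ ⟨x, hx, rfl⟩ ⟨k, ?_⟩
    rw [← QuotientGroup.mk_pow, hk, QuotientGroup.mk_one]
  · rintro h _ ⟨x, hx, rfl⟩ ⟨k, hk⟩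
    rw [QuotientGroup.mk'_apply] at hk ⊢
    rw [mk_mem_hypercentre_iff A hA]
    refine h x hx ⟨k + 1, ?_⟩
    rw [← QuotientGroup.mk_pow, QuotientGroup.eq_one_iff] at hk
    have h1 : (⟨x ^ p ^ k, hk⟩ : A) ^ Nat.card A = 1 := pow_card_eq_one'
    rw [pow_succ, pow_mul]
    simpa [Subtype.ext_iff, hcard] using h1

theorem pElementsHypercentral_iff_factorization [Finite G] (p : ℕ) (hp : p.Prime) (N : Subgroup G)
    (hN : N.Normal) :
    PElementsHypercentral N p ↔
      (Nat.card (primePowerIndexElements N p)).factorization p =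
        (Nat.card N).factorization p := by
  have : Fact p.Prime := ⟨hp⟩
  induction hn : Nat.card G using Nat.strong_induction_on generalizing G with
  | _ n ih =>
  by_cases hZ : p ∣ Nat.card ↥(N ⊓ Subgroup.center G)
  · obtain ⟨⟨z, hzN, hzC⟩, hz⟩ := exists_prime_orderOf_dvd_card' p hZ
    rw [← Subgroup.orderOf_coe] at hz
    change orderOf z = p at hz
    set A := Subgroup.zpowers z with hAdef
    have hAN : A ≤ N := Subgroup.zpowers_le.2 hzN
    have hA : A ≤ Subgroup.center G := Subgroup.zpowers_le.2 hzC
    have hcard : Nat.card A = p := by rw [hAdef, Nat.card_zpowers, hz]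
    have hAn : A.Normal := 
      ⟨fun a ha g => by
        rwa [Subgroup.mem_center_iff.1 (hA ha) g, mul_inv_cancel_right]⟩
    have hlt : Nat.card (G ⧸ A) < n := by
      rw [← hn, Subgroup.card_eq_card_quotient_mul_card_subgroup A, hcard]
      exact lt_mul_of_one_lt_right Nat.card_pos hp.one_lt
    have key := ih _ hlt (N.map (QuotientGroup.mk' A))
      (hN.map _ (QuotientGroup.mk'_surjective A)) rfl
    refine (pElementsHypercentral_map_iff N A hA p hcard).symm.trans (key.trans ?_)
    rw [← preimage_primePowerIndexElements N A hAN hA p hp hcard, card_preimage_mk, hcard]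
    have hNcard : Nat.card N = p * Nat.card (N.map (QuotientGroup.mk' A)) := by
      rw [← hcard, ← SetLike.coe_sort_coe (N.map (QuotientGroup.mk' A)), ← card_preimage_mk]
      have : QuotientGroup.mk ⁻¹' (N.map (QuotientGroup.mk' A) : Set (G ⧸ A)) = (N : Set G) :=
        congrArg SetLike.coe (Subgroup.comap_map_eq_self (f := QuotientGroup.mk' A)
          (by rwa [QuotientGroup.ker_mk']))
      rw [this]
      rfl
    have hS : Nat.card (primePowerIndexElements (N.map (QuotientGroup.mk' A)) p) ≠ 0 := by
      have : Nonempty (primePowerIndexElements (N.map (QuotientGroup.mk' A)) p) :=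
        ⟨⟨1, Subgroup.one_mem _, 0, by
          simp [Subgroup.index_eq_one, Subgroup.centralizer_eq_top_iff_subset]⟩⟩
      exact Nat.card_pos.ne'
    rw [hNcard, Nat.factorization_mul hp.ne_zero hS,
      Nat.factorization_mul hp.ne_zero Nat.card_pos.ne']
    simp
  · have hS : ¬ p ∣ Nat.card (primePowerIndexElements N p) := by
      rwa [(card_primePowerIndexElements_modEq N hN p hp).dvd_iff dvd_rfl]
    rw [Nat.factorization_eq_zero_of_not_dvd hS, eq_comm, Nat.factorization_eq_zero_iff]
    have htors : ∀ z ∈ N, z ∈ Subgroup.center G → z ^ p = 1 → z = 1 := by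
      intro z hzN hzC hz
      by_contra h1
      refine hZ ?_
      rw [← orderOf_eq_prime hz h1]
      exact Subgroup.orderOf_dvd_natCard _ ⟨hzN, hzC⟩
    constructor
    · intro h
      refine Or.inr (Or.inl fun hdvd => ?_)
      obtain ⟨x, hx⟩ := exists_prime_orderOf_dvd_card' p hdvd
      rw [← Subgroup.orderOf_coe] at hx
      have hxp : (x : G) ^ p = 1 := hx ▸ pow_orderOf_eq_one (x : G)
      have := eq_one_of_mem_hypercentre N hN p htors x.2
        (h x x.2 ⟨1, by rwa [pow_one]⟩) hxp
      rw [this, orderOf_one] at hx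
      exact hp.one_lt.ne hx
    · intro h x hxN ⟨k, hk⟩
      have hnd : ¬ p ∣ Nat.card N := by
        rcases h with h | h | h
        · exact absurd hp h
        · exact h
        · exact absurd h Nat.card_pos.ne'
      have h1 := orderOf_dvd_of_pow_eq_one hk
      have h2 := Subgroup.orderOf_dvd_natCard N hxN
      have hco : Nat.Coprime (p ^ k) (Nat.card N) :=
        Nat.Coprime.pow_left k ((Nat.Prime.coprime_iff_not_dvd hp).2 hnd)
      have := Nat.eq_one_of_dvd_coprimes hco h1 h2
      rw [orderOf_eq_one_iff.1 this]
      exact Subgroup.one_mem _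

theorem exists_sylow_le_hypercentre_iff [Finite G] (N : Subgroup G) (p : ℕ) (hp : p.Prime) :
    (∃ P : Sylow p ↥N, (P : Subgroup ↥N).map N.subtype ≤
      ⨆ n, Subgroup.upperCentralSeries G n) ↔ PElementsHypercentral N p := by
  have : Fact p.Prime := ⟨hp⟩
  have hnormal : (⨆ n, Subgroup.upperCentralSeries G n).Normal := by
    refine ⟨fun x hx g => ?_⟩
    obtain ⟨n, hn⟩ := mem_iSup_upperCentralSeries_iff.1 hx
    exact mem_iSup_upperCentralSeries_iff.2 ⟨n, Subgroup.Normal.conj_mem inferInstance x hn g⟩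
  constructor
  · rintro ⟨P, hP⟩ x hx ⟨k, hk⟩
    set K := (⨆ n, Subgroup.upperCentralSeries G n).subgroupOf N with hK
    have hPK : (P : Subgroup N) ≤ K := Subgroup.map_le_iff_le_comap.1 hP
    have hnd : ¬ p ∣ K.index := fun h => P.not_dvd_index (h.trans (Subgroup.index_dvd_of_le hPK))
    have hco : Nat.Coprime (p ^ k) K.index :=
      Nat.Coprime.pow_left k ((Nat.Prime.coprime_iff_not_dvd hp).2 hnd)
    have h1 : orderOf ((⟨x, hx⟩ : N) : N ⧸ K) ∣ p ^ k := by
      refine orderOf_dvd_of_pow_eq_one ?_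
      rw [← QuotientGroup.mk_pow, show (⟨x, hx⟩ : N) ^ p ^ k = 1 from Subtype.ext hk,
        QuotientGroup.mk_one]
    have h2 : orderOf ((⟨x, hx⟩ : N) : N ⧸ K) ∣ K.index := orderOf_dvd_natCard _
    have h3 := orderOf_eq_one_iff.1 (Nat.eq_one_of_dvd_coprimes hco h1 h2)
    exact Subgroup.mem_subgroupOf.1 ((QuotientGroup.eq_one_iff _).1 h3)
  · intro h
    refine ⟨default, ?_⟩
    rintro _ ⟨x, hx, rfl⟩
    obtain ⟨k, hk⟩ := (default : Sylow p N).isPGroup' ⟨x, hx⟩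
    exact h _ x.2 ⟨k, by simpa [Subtype.ext_iff] using hk⟩

end Hypercentre

/-- A Sylow p-subgroup of N is hypercentral in G iff |S_p^G(N)|_p = |N|_p. -/
theorem stmt_4 {G : Type*} [Group G] [Finite G] (N : Subgroup G) (hN : N.Normal)
    (p : ℕ) (hp : p.Prime) :
    (∃ P : Sylow p ↥N, (P : Subgroup ↥N).map N.subtype ≤ ⨆ n, upperCentralSeries G n) ↔
      p ^ (Nat.card {g : G | g ∈ N ∧ ∃ k, (Subgroup.centralizer {g}).index = p ^ k}).factorization p
        = p ^ (Nat.card ↥N).factorization p := by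
  refine (exists_sylow_le_hypercentre_iff N p hp).trans
    ((pElementsHypercentral_iff_factorization p hp N hN).trans ?_)
  exact (Nat.pow_right_injective hp.two_le).eq_iff.symm
end

section
/- Let G be a finite group, N a normal subgroup of G, and p a prime. Then a Sylow p-subgroup of N is contained in the hypercentre Z_∞(G) if and only if every p-element of N commutes with every element of O^p(G), where O^p(G) is the subgroup of G generated by all p'-elements of G. -/
open scoped commutatorElement

/-- A `p`-element in a term of the upper central series commutes with every `p'`-element. -/
theorem commute_of_mem_upperCentralSeries {p : ℕ} (hp : p.Prime) (n : ℕ) {G : Type*} [Group G]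
    {x y : G} (hx : x ∈ Subgroup.upperCentralSeries G n) {k : ℕ} (hxp : x ^ p ^ k = 1)
    {m : ℕ} (hm : ¬ p ∣ m) (hy : y ^ m = 1) : Commute x y := by
  induction n generalizing G with
  | zero =>
    obtain rfl : x = 1 := by simpa using hx
    exact Commute.one_left y
  | succ n ih =>
    have hx' : (x : G ⧸ Subgroup.center G) ∈
        Subgroup.upperCentralSeries (G ⧸ Subgroup.center G) n := by
      rw [← Nat.succ_eq_add_one, ← Subgroup.comap_upperCentralSeries_quotient_center] at hx
      exact hx
    have hcomm : Commute (x : G ⧸ Subgroup.center G) y :=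
      ih hx' (by rw [← QuotientGroup.mk_pow, hxp, QuotientGroup.mk_one])
        (by rw [← QuotientGroup.mk_pow, hy, QuotientGroup.mk_one])
    have hz : ⁅x, y⁆ ∈ Subgroup.center G := by
      rw [← QuotientGroup.eq_one_iff]
      exact commutatorElement_eq_one_iff_commute.mpr hcomm
    have hzc : ∀ g : G, Commute ⁅x, y⁆ g := fun g => (Subgroup.mem_center_iff.mp hz g).symm
    have hzx : ⁅x, y⁆ ^ p ^ k = 1 := by
      have hconj : ⁅x, y⁆⁻¹ * x = y * x * y⁻¹ := by
        simp [commutatorElement_def, mul_assoc]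
      have := congrArg (· ^ p ^ k) hconj
      simpa only [(hzc x).inv_left.mul_pow, conj_pow, hxp, mul_one, mul_inv_cancel, inv_pow,
        inv_eq_one] using this
    have hzy : ⁅x, y⁆ ^ m = 1 := by
      have hconj : ⁅x, y⁆ * y = x * y * x⁻¹ := by simp [commutatorElement_def]
      have := congrArg (· ^ m) hconj
      simpa [(hzc y).mul_pow, conj_pow, hy] using this
    have hcop : (p ^ k).Coprime m := Nat.Coprime.pow_left k (hp.coprime_iff_not_dvd.mpr hm)
    rw [← commutatorElement_eq_one_iff_commute, ← orderOf_eq_one_iff]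
    exact Nat.eq_one_of_dvd_coprimes hcop (orderOf_dvd_of_pow_eq_one hzx)
      (orderOf_dvd_of_pow_eq_one hzy)

/-- The subgroup generated by the `p'`-elements is normal. -/
theorem normal_closure_setOf_not_dvd_orderOf (G : Type*) [Group G] (p : ℕ) :
    (Subgroup.closure {y : G | ¬ p ∣ orderOf y}).Normal := by
  rw [← Subgroup.normalizer_eq_top_iff, eq_top_iff, Subgroup.le_normalizer_closure_iff]
  intro h _ g hg
  refine Subgroup.subset_closure ?_
  have : orderOf (h * g * h⁻¹) = orderOf g := (MulAut.conj h).orderOf_eq g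
  simpa [this] using hg

/-- A Sylow `p`-subgroup together with the `p'`-elements generates the whole group. -/
theorem Sylow.sup_closure_setOf_not_dvd_orderOf {G : Type*} [Group G] [Finite G] {p : ℕ}
    [Fact p.Prime] (Q : Sylow p G) :
    (Q : Subgroup G) ⊔ Subgroup.closure {y : G | ¬ p ∣ orderOf y} = ⊤ := by
  have hO := normal_closure_setOf_not_dvd_orderOf G p
  set O := Subgroup.closure {y : G | ¬ p ∣ orderOf y} with hOdef
  have hpq : IsPGroup p (G ⧸ O) := by
    intro q
    obtain ⟨g, rfl⟩ := QuotientGroup.mk_surjective q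
    refine ⟨(orderOf g).factorization p, ?_⟩
    rw [← QuotientGroup.mk_pow, QuotientGroup.eq_one_iff]
    refine Subgroup.subset_closure ?_
    rw [Set.mem_ofPred_eq, orderOf_pow_of_dvd (pow_ne_zero _ (Fact.out : p.Prime).ne_zero)
      (Nat.ordProj_dvd _ _)]
    exact Nat.not_dvd_ordCompl Fact.out (orderOf_pos g).ne'
  obtain ⟨n, hn⟩ := IsPGroup.iff_card.mp hpq
  rw [← Subgroup.index_eq_one]
  refine Nat.eq_one_of_dvd_coprimes
    (Nat.Coprime.pow_left n ((Nat.Prime.coprime_iff_not_dvd Fact.out).mpr Q.not_dvd_index)) ?_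
    (Subgroup.index_dvd_of_le le_sup_left)
  rw [← hn, ← Subgroup.index_eq_card]
  exact Subgroup.index_dvd_of_le le_sup_right

/-- If a normal subgroup `N` meets a Sylow subgroup `Q` in elements centralized by all
`p'`-elements, then on `N` the upper central series of `Q` is contained in that of `G`. -/
theorem Sylow.coe_mem_upperCentralSeries {G : Type*} [Group G] [Finite G] {p : ℕ}
    [Fact p.Prime] (Q : Sylow p G) {N : Subgroup G} (hN : N.Normal)
    (h : ∀ x ∈ N, x ∈ Q → ∀ y ∈ Subgroup.closure {y : G | ¬ p ∣ orderOf y}, Commute x y)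
    (n : ℕ) (x : (Q : Subgroup G)) (hx : x ∈ Subgroup.upperCentralSeries Q n) (hxN : (x : G) ∈ N) :
    (x : G) ∈ Subgroup.upperCentralSeries G n := by
  induction n generalizing x with
  | zero =>
    obtain rfl : x = 1 := by simpa using hx
    exact one_mem _
  | succ n ih =>
    rw [Subgroup.mem_upperCentralSeries_succ_iff] at hx ⊢
    intro g
    have := normal_closure_setOf_not_dvd_orderOf G p
    have hg : g ∈ (Q : Subgroup G) ⊔ Subgroup.closure {y : G | ¬ p ∣ orderOf y} :=
      Q.sup_closure_setOf_not_dvd_orderOf ▸ Subgroup.mem_top g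
    obtain ⟨q, hq, o, ho, rfl⟩ := Subgroup.mem_sup_of_normal_right.mp hg
    have hxo : o * (x : G)⁻¹ * o⁻¹ = (x : G)⁻¹ := by
      rw [← (h x hxN x.2 o ho).inv_left.eq, mul_inv_cancel_right]
    have hcomm : ⁅(x : G), q * o⁆ = ((⁅x, ⟨q, hq⟩⁆ : (Q : Subgroup G)) : G) := by
      change (x : G) * (q * o) * (x : G)⁻¹ * (q * o)⁻¹ = x * q * (x : G)⁻¹ * q⁻¹
      calc _ = (x : G) * q * (o * (x : G)⁻¹ * o⁻¹) * q⁻¹ := by group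
        _ = _ := by rw [hxo]
    rw [hcomm]
    refine ih _ (hx _) ?_
    change (x : G) * q * (x : G)⁻¹ * q⁻¹ ∈ N
    rw [mul_assoc (x : G), mul_assoc (x : G)]
    exact mul_mem hxN (hN.conj_mem _ (inv_mem hxN) q)

/-- A Sylow p-subgroup of N lies in Z_∞(G) iff every p-element of N commutes
with every element of O^p(G), the subgroup generated by all p'-elements of G. -/
theorem stmt_9 {G : Type*} [Group G] [Finite G] (N : Subgroup G) (hN : N.Normal)
    (p : ℕ) (hp : p.Prime) :
    (∃ P : Sylow p ↥N, (P : Subgroup ↥N).map N.subtype ≤ ⨆ n, upperCentralSeries G n) ↔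
      ∀ x ∈ N, (∃ k, orderOf x = p ^ k) →
        ∀ y ∈ Subgroup.closure {y : G | ¬ p ∣ orderOf y}, Commute x y := by
  have : Fact p.Prime := ⟨hp⟩
  constructor
  · rintro ⟨P, hP⟩ x hxN ⟨k, hk⟩ y hy
    have hxk : x ^ p ^ k = 1 := hk ▸ pow_orderOf_eq_one x
    have hpz : IsPGroup p (Subgroup.zpowers (⟨x, hxN⟩ : N)) :=
      IsPGroup.of_card (n := k) (by rw [Nat.card_zpowers, Subgroup.orderOf_mk, hk])
    obtain ⟨Q, hQ⟩ := hpz.exists_le_sylow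
    obtain ⟨g, rfl⟩ := MulAction.exists_smul_eq N P Q
    have hxQ := hQ (Subgroup.mem_zpowers _)
    rw [Sylow.coe_subgroup_smul, Subgroup.mem_smul_pointwise_iff_exists] at hxQ
    obtain ⟨s, hs, hsx⟩ := hxQ
    have hsZ : (s : G) ∈ ⨆ n, Subgroup.upperCentralSeries G n :=
      hP (Subgroup.mem_map_of_mem N.subtype hs)
    rw [Subgroup.mem_iSup_of_directed
      (Subgroup.upperCentralSeries_mono (G := G)).directed_le] at hsZ
    obtain ⟨n, hn⟩ := hsZ
    have hx : x ∈ Subgroup.upperCentralSeries G n := by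
      have hxs : x = g * s * (g : G)⁻¹ := (congrArg Subtype.val hsx).symm
      rw [hxs]
      exact Subgroup.Normal.conj_mem inferInstance _ hn _
    have hle : Subgroup.closure {y : G | ¬ p ∣ orderOf y} ≤ Subgroup.centralizer {x} := by
      rw [Subgroup.closure_le]
      intro z hz
      exact Subgroup.mem_centralizer_singleton_iff.mpr
        (commute_of_mem_upperCentralSeries hp n hx hxk hz (pow_orderOf_eq_one z)).symm
    exact (Subgroup.mem_centralizer_singleton_iff.mp (hle hy)).symm
  · intro h
    obtain ⟨P⟩ := (inferInstance : Nonempty (Sylow p N))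
    refine ⟨P, ?_⟩
    obtain ⟨Q, hQ⟩ := (P.isPGroup'.map N.subtype).exists_le_sylow
    obtain ⟨n, hn⟩ := Q.isPGroup'.isNilpotent.nilpotent
    intro x hx
    refine Subgroup.mem_iSup_of_mem n (Q.coe_mem_upperCentralSeries hN ?_ n ⟨x, hQ hx⟩
      (hn ▸ Subgroup.mem_top _) (Subgroup.map_subtype_le _ hx))
    intro z hzN hzQ
    refine h z hzN ?_
    obtain ⟨k, hk⟩ := IsPGroup.iff_orderOf.mp Q.isPGroup' ⟨z, hzQ⟩
    exact ⟨k, by rw [← hk, Subgroup.orderOf_mk]⟩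
end

section
/- Let G be a finite group, N a normal subgroup of G, and p a prime. Then the order of N ∩ Z(G) divides the cardinality of S_{p'}^G(N). -/
/-- The cardinality of a subgroup divides that of any set stable under right multiplication
by it. -/
theorem Subgroup.card_dvd_card_of_mul_mem {G : Type*} [Group G] (H : Subgroup G) (S : Set G)
    (hS : ∀ g ∈ S, ∀ h ∈ H, g * h ∈ S) : Nat.card H ∣ Nat.card S := by
  have key : (QuotientGroup.mk : G → G ⧸ H) ⁻¹' (QuotientGroup.mk '' S) = S := by
    refine Set.Subset.antisymm ?_ (Set.subset_preimage_image _ _)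
    rintro x ⟨g, hg, hgx⟩
    simpa using hS g hg _ (QuotientGroup.eq.mp hgx)
  rw [← key, Nat.card_congr (QuotientGroup.preimageMkEquivSubgroupProdSet H _), Nat.card_prod]
  exact dvd_mul_right _ _

theorem Subgroup.centralizer_singleton_mul_of_mem_center {G : Type*} [Group G] (g : G) {z : G}
    (hz : z ∈ Subgroup.center G) :
    Subgroup.centralizer {g * z} = Subgroup.centralizer {g} := by
  ext x
  rw [Subgroup.mem_centralizer_singleton_iff, Subgroup.mem_centralizer_singleton_iff, mul_assoc g,
    ← Subgroup.mem_center_iff.mp hz x, ← mul_assoc, ← mul_assoc, mul_left_inj]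

/-- |N ∩ Z(G)| divides |S_{p'}^G(N)|. -/
theorem stmt_10 {G : Type*} [Group G] [Finite G] (N : Subgroup G) (hN : N.Normal)
    (p : ℕ) (hp : p.Prime) :
    Nat.card ↥(N ⊓ Subgroup.center G)
      ∣ Nat.card {g : G | g ∈ N ∧ ¬ p ∣ (Subgroup.centralizer {g}).index} := by
  refine Subgroup.card_dvd_card_of_mul_mem _ _ fun g hg z hz => ⟨N.mul_mem hg.1 hz.1, ?_⟩
  rw [Subgroup.centralizer_singleton_mul_of_mem_center g hz.2]
  exact hg.2
end

section
/- Let G be a finite group, N a normal subgroup of G, and p a prime. Fix a Sylow p-subgroup P of G and set Z := P ∩ N ∩ Z(G). Then Z is normal in G, and for every n ∈ N whose G-conjugacy class size |g^G| is a p'-number, the centralizer of the coset nZ in G/Z equals C_G(n)/Z. -/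
theorem normal_of_le_center {G : Type*} [Group G] (H : Subgroup G)
    (h : H ≤ Subgroup.center G) : H.Normal := by
  refine ⟨fun a ha g => ?_⟩
  have := (Subgroup.mem_center_iff.mp (h ha)) g
  rw [this]
  simpa using ha

open scoped commutatorElement

theorem commutatorElement_mem_of_mem_comap_centralizer {G : Type*} [Group G] {Z : Subgroup G}
    [Z.Normal] {g n : G}
    (hg : g ∈ (Subgroup.centralizer {QuotientGroup.mk' Z n}).comap (QuotientGroup.mk' Z)) :
    ⁅g, n⁆ ∈ Z := by
  rw [← QuotientGroup.eq_one_iff]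
  exact commutatorElement_eq_one_iff_mul_comm.mpr
    (Subgroup.mem_centralizer_singleton_iff.mp (Subgroup.mem_comap.mp hg))

/-- On the elements centralizing `n` modulo a central subgroup `Z`, the map `g ↦ ⁅g, n⁆` is
multiplicative. -/
def commutatorHom {G : Type*} [Group G] (Z : Subgroup G) [Z.Normal]
    (hZ : Z ≤ Subgroup.center G) (n : G) :
    (Subgroup.centralizer {QuotientGroup.mk' Z n}).comap (QuotientGroup.mk' Z) →* Z :=
  MonoidHom.mk'
    (fun g => ⟨⁅(g : G), n⁆, commutatorElement_mem_of_mem_comap_centralizer g.2⟩)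
    (fun a b => by
      have hc := Subgroup.mem_center_iff.mp
        (hZ (commutatorElement_mem_of_mem_comap_centralizer b.2))
      apply Subtype.ext
      change ⁅(a : G) * b, n⁆ = ⁅(a : G), n⁆ * ⁅(b : G), n⁆
      calc ⁅(a : G) * b, n⁆ = a * ⁅(b : G), n⁆ * (n * (a : G)⁻¹ * n⁻¹) := by
            simp only [commutatorElement_def]; group
        _ = ⁅(b : G), n⁆ * ⁅(a : G), n⁆ := by
            rw [hc]; simp only [commutatorElement_def]; group
        _ = ⁅(a : G), n⁆ * ⁅(b : G), n⁆ := (hc _).symm)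

theorem ker_commutatorHom {G : Type*} [Group G] (Z : Subgroup G) [Z.Normal]
    (hZ : Z ≤ Subgroup.center G) (n : G) :
    (commutatorHom Z hZ n).ker = (Subgroup.centralizer {n}).subgroupOf
      ((Subgroup.centralizer {QuotientGroup.mk' Z n}).comap (QuotientGroup.mk' Z)) := by
  ext g
  rw [MonoidHom.mem_ker, Subgroup.mem_subgroupOf, Subgroup.mem_centralizer_singleton_iff,
    ← commutatorElement_eq_one_iff_mul_comm, Subtype.ext_iff]
  rfl

theorem centralizer_le_comap_centralizer {G : Type*} [Group G] (Z : Subgroup G) [Z.Normal]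
    (n : G) : Subgroup.centralizer {n} ≤
      (Subgroup.centralizer {QuotientGroup.mk' Z n}).comap (QuotientGroup.mk' Z) := by
  intro g hg
  rw [Subgroup.mem_comap, Subgroup.mem_centralizer_singleton_iff, ← map_mul, ← map_mul,
    Subgroup.mem_centralizer_singleton_iff.mp hg]

/-- A central `p`-subgroup does not enlarge the centralizer of an element whose conjugacy class
has `p'`-size. -/
theorem centralizer_mk_eq_map_centralizer {G : Type*} [Group G] {p : ℕ} (hp : p.Prime)
    (Z : Subgroup G) [Z.Normal] [Finite Z] (hZ : Z ≤ Subgroup.center G) (hpZ : IsPGroup p Z)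
    (n : G) (hn : ¬ p ∣ (Subgroup.centralizer {n}).index) :
    Subgroup.centralizer {QuotientGroup.mk' Z n}
      = (Subgroup.centralizer {n}).map (QuotientGroup.mk' Z) := by
  have : Fact p.Prime := ⟨hp⟩
  set C := Subgroup.centralizer {n} with hC
  set D := (Subgroup.centralizer {QuotientGroup.mk' Z n}).comap (QuotientGroup.mk' Z) with hD
  have hCD : C ≤ D := centralizer_le_comap_centralizer Z n
  have hdvd : C.relIndex D ∣ Nat.card Z := by
    rw [Subgroup.relIndex, ← ker_commutatorHom Z hZ n, Subgroup.index_ker]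
    exact Subgroup.card_subgroup_dvd_card _
  obtain ⟨k, hk⟩ := IsPGroup.iff_card.mp hpZ
  have hone : C.relIndex D = 1 := by
    rw [hk] at hdvd
    refine Nat.Coprime.eq_one_of_dvd (Nat.Coprime.pow_right k ?_) hdvd
    exact ((Nat.Prime.coprime_iff_not_dvd hp).mpr fun h =>
      hn (h.trans (Subgroup.relIndex_dvd_index_of_le hCD))).symm
  rw [hCD.antisymm (Subgroup.relIndex_eq_one.mp hone), hD,
    Subgroup.map_comap_eq_self_of_surjective (QuotientGroup.mk'_surjective Z)]

/-- With Z := P ∩ N ∩ Z(G) for P a Sylow p-subgroup of G: Z is normal in G, and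
for every n ∈ N with |n^G| a p'-number, C_{G/Z}(nZ) = C_G(n)/Z. -/
theorem stmt_15 {G : Type*} [Group G] [Finite G] (N : Subgroup G) (hN : N.Normal)
    (p : ℕ) (hp : p.Prime) (P : Sylow p G) :
    let Z : Subgroup G := (P : Subgroup G) ⊓ N ⊓ Subgroup.center G
    haveI : Z.Normal := normal_of_le_center Z inf_le_right
    Z.Normal ∧ ∀ n ∈ N, ¬ p ∣ (Subgroup.centralizer {n}).index →
      Subgroup.centralizer {QuotientGroup.mk' Z n}
        = (Subgroup.centralizer {n}).map (QuotientGroup.mk' Z) := by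
  intro Z
  have hZ : Z ≤ Subgroup.center G := inf_le_right
  have : Z.Normal := normal_of_le_center Z hZ
  have hpZ : IsPGroup p Z := P.isPGroup'.to_le (inf_le_left.trans inf_le_left)
  exact ⟨this, fun n _ hn => centralizer_mk_eq_map_centralizer hp Z hZ hpZ n hn⟩
end

section
/- Let G be a finite group, N a normal subgroup of G, and p a prime. If P is a Sylow p-subgroup of G, then Z(P) ∩ N is a Sylow p-subgroup of C_N(P) = N ∩ C_G(P). -/
/-- A `p`-subgroup centralizing a Sylow `p`-subgroup is contained in it. -/
theorem IsPGroup.le_sylow_of_le_centralizer {G : Type*} [Group G] {p : ℕ} {R : Subgroup G}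
    (hR : IsPGroup p R) (P : Sylow p G)
    (h : R ≤ Subgroup.centralizer ((P : Subgroup G) : Set G)) : R ≤ P :=
  inf_eq_left.mp <| (hR.inf_normalizer_sylow P).symm.trans <|
    inf_eq_left.mpr (h.trans (Subgroup.centralizer_le_normalizer _))

/-- If P is a Sylow p-subgroup of G, then Z(P) ∩ N is a Sylow p-subgroup of
C_N(P) = N ∩ C_G(P). -/
theorem stmt_16 {G : Type*} [Group G] [Finite G] (N : Subgroup G) (hN : N.Normal)
    (p : ℕ) (hp : p.Prime) (P : Sylow p G) :
    ∃ Q : Sylow p ↥(N ⊓ Subgroup.centralizer ((P : Subgroup G) : Set G)),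
      (Q : Subgroup ↥(N ⊓ Subgroup.centralizer ((P : Subgroup G) : Set G))).map
          (N ⊓ Subgroup.centralizer ((P : Subgroup G) : Set G)).subtype
        = (Subgroup.center ↥(P : Subgroup G)).map (P : Subgroup G).subtype ⊓ N := by
  set C := N ⊓ Subgroup.centralizer ((P : Subgroup G) : Set G) with hC
  refine ⟨⟨(P : Subgroup G).subgroupOf C,
    P.isPGroup'.comap_of_injective C.subtype C.subtype_injective, fun {R} hR hle => ?_⟩, ?_⟩
  · refine le_antisymm (Subgroup.map_le_iff_le_comap.mp ?_) hle
    exact (hR.map C.subtype).le_sylow_of_le_centralizer P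
      ((Subgroup.map_subtype_le R).trans inf_le_right)
  · change ((P : Subgroup G).subgroupOf C).map C.subtype = _
    rw [Subgroup.subgroupOf_map_subtype, hC]
    ext x
    simp only [Subgroup.mem_inf, Subgroup.mem_centralizer_iff, Subgroup.mem_map,
      Subgroup.mem_center_iff, Subgroup.coe_subtype]
    constructor
    · rintro ⟨hxP, hxN, hx⟩
      exact ⟨⟨⟨x, hxP⟩, fun g => Subtype.ext (hx g g.2), rfl⟩, hxN⟩
    · rintro ⟨⟨z, hz, rfl⟩, hxN⟩
      exact ⟨z.2, hxN, fun g hg => congrArg Subtype.val (hz ⟨g, hg⟩)⟩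
end

section
/- Let G be a finite group, N a normal subgroup of G, and p a prime. Fix a Sylow p-subgroup P of G and set Z := P ∩ N ∩ Z(G). For n ∈ N whose G-conjugacy class size is a p'-number, the coset nZ ∈ G/Z is fixed under conjugation by every element of the image of P in G/Z if and only if n ∈ C_N(P), i.e. n commutes with every element of P. -/
/-- The elements `g` with `g * n * g⁻¹ * n⁻¹ ∈ K`, for a central subgroup `K`. -/
def centralizerMod {G : Type*} [Group G] (K : Subgroup G) (hK : K ≤ Subgroup.center G) (n : G) :
    Subgroup G where
  carrier := {g | g * n * g⁻¹ * n⁻¹ ∈ K}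
  one_mem' := by simp
  mul_mem' {a b} ha hb := by
    have h := Subgroup.mem_center_iff.mp (hK hb) a
    have e : a * b * n * (a * b)⁻¹ * n⁻¹ = (b * n * b⁻¹ * n⁻¹) * (a * n * a⁻¹ * n⁻¹) := by
      calc _ = (a * (b * n * b⁻¹ * n⁻¹)) * n * a⁻¹ * n⁻¹ := by group
        _ = _ := by rw [h]; group
    simpa only [Set.mem_ofPred_eq, e] using mul_mem hb ha
  inv_mem' {a} ha := by
    have h := Subgroup.mem_center_iff.mp (hK (inv_mem ha)) a⁻¹
    have e : a⁻¹ * n * a⁻¹⁻¹ * n⁻¹ = (a * n * a⁻¹ * n⁻¹)⁻¹ := by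
      calc _ = (a⁻¹ * (a * n * a⁻¹ * n⁻¹)⁻¹) * a := by group
        _ = _ := by rw [h]; group
    simpa only [Set.mem_ofPred_eq, e] using inv_mem ha

/-- The commutator map `g ↦ g * n * g⁻¹ * n⁻¹` into a central subgroup `K`. -/
def commutatorMod {G : Type*} [Group G] (K : Subgroup G) (hK : K ≤ Subgroup.center G) (n : G) :
    centralizerMod K hK n →* K where
  toFun g := ⟨g * n * (g : G)⁻¹ * n⁻¹, g.2⟩
  map_one' := by ext; simp
  map_mul' a b := by
    ext
    have hc := Subgroup.mem_center_iff.mp (hK b.2) a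
    have hc' := Subgroup.mem_center_iff.mp (hK b.2) (a * n * (a : G)⁻¹ * n⁻¹)
    calc ((a * b : centralizerMod K hK n) : G) * n * ((a * b : centralizerMod K hK n) : G)⁻¹ * n⁻¹
        = (a * (b * n * (b : G)⁻¹ * n⁻¹)) * n * (a : G)⁻¹ * n⁻¹ := by push_cast; group
      _ = (b * n * (b : G)⁻¹ * n⁻¹) * (a * n * (a : G)⁻¹ * n⁻¹) := by rw [hc]; group
      _ = _ := hc'.symm

theorem commute_of_commutator_mem_central_pGroup {G : Type*} [Group G] [Finite G] {p : ℕ}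
    (hp : p.Prime) (K : Subgroup G) (hK : K ≤ Subgroup.center G) (hKp : IsPGroup p K) (n : G)
    (hn : ¬ p ∣ (Subgroup.centralizer {n}).index) {x : G} (hx : x * n * x⁻¹ * n⁻¹ ∈ K) :
    Commute n x := by
  have : Fact p.Prime := ⟨hp⟩
  let f := commutatorMod K hK n
  have mem_ker (y : centralizerMod K hK n) : y ∈ f.ker ↔ (y : G) * n = n * y := by
    rw [MonoidHom.mem_ker, Subtype.ext_iff]
    change (y : G) * n * (y : G)⁻¹ * n⁻¹ = 1 ↔ _
    rw [mul_inv_eq_one, mul_inv_eq_iff_eq_mul]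
  have hker : f.ker = (Subgroup.centralizer {n}).subgroupOf (centralizerMod K hK n) := by
    ext y
    rw [mem_ker, Subgroup.mem_subgroupOf, Subgroup.mem_centralizer_singleton_iff]
  have hle : Subgroup.centralizer {n} ≤ centralizerMod K hK n := by
    intro y hy
    rw [Subgroup.mem_centralizer_singleton_iff] at hy
    change y * n * y⁻¹ * n⁻¹ ∈ K
    rw [hy]
    simp
  have hdvd : f.ker.index ∣ (Subgroup.centralizer {n}).index :=
    hker ▸ Subgroup.relIndex_dvd_index_of_le hle
  obtain ⟨k, hk⟩ := IsPGroup.iff_card.mp hKp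
  have hcard : f.ker.index ∣ p ^ k := by
    rw [← hk, Subgroup.index_ker]
    exact Subgroup.card_subgroup_dvd_card _
  have hone : f.ker.index = 1 := by
    obtain ⟨j, -, hj⟩ := (Nat.dvd_prime_pow hp).mp hcard
    rcases j with _ | j
    · simpa using hj
    · exact absurd ((hj ▸ dvd_pow_self p j.succ_ne_zero).trans hdvd) hn
  have hmem : (⟨x, hx⟩ : centralizerMod K hK n) ∈ f.ker :=
    Subgroup.index_eq_one.mp hone ▸ Subgroup.mem_top _
  exact ((mem_ker _).mp hmem).symm

/-- With Z := P ∩ N ∩ Z(G): for n ∈ N with |n^G| a p'-number, the coset nZ is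
fixed by conjugation by the image of P in G/Z iff n commutes with every element
of P. -/
theorem stmt_17 {G : Type*} [Group G] [Finite G] (N : Subgroup G) (hN : N.Normal)
    (p : ℕ) (hp : p.Prime) (P : Sylow p G) :
    let Z : Subgroup G := (P : Subgroup G) ⊓ N ⊓ Subgroup.center G
    haveI : Z.Normal := normal_of_le_center Z inf_le_right
    ∀ n ∈ N, ¬ p ∣ (Subgroup.centralizer {n}).index →
      ((∀ x ∈ (P : Subgroup G),
          QuotientGroup.mk' Z x * QuotientGroup.mk' Z n * (QuotientGroup.mk' Z x)⁻¹
            = QuotientGroup.mk' Z n) ↔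
        ∀ x ∈ (P : Subgroup G), Commute n x) := by
  intro Z n hnN hn
  have : Z.Normal := normal_of_le_center Z inf_le_right
  refine ⟨fun h x hx => ?_, fun h x hx => ?_⟩
  · refine commute_of_commutator_mem_central_pGroup hp Z inf_le_right
      (P.isPGroup'.to_le (inf_le_left.trans inf_le_left)) n hn ?_
    rw [← QuotientGroup.eq_one_iff]
    exact mul_inv_eq_one.mpr (h x hx)
  · rw [← map_mul, ← (h x hx).eq, map_mul, mul_inv_cancel_right]
end

section
/- Let G be a finite group and N a normal subgroup of G. Then N is contained in the hypercentre Z_∞(G) if and only if for every prime p dividing |N|, some Sylow p-subgroup of N is contained in Z_∞(G). -/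
/-- A subgroup of a finite group that contains a Sylow `p`-subgroup for every prime `p` dividing
the order of the group is the whole group. -/
theorem Subgroup.eq_top_of_forall_exists_sylow_le {H : Type*} [Group H] [Finite H]
    (K : Subgroup H)
    (hK : ∀ p : ℕ, p.Prime → p ∣ Nat.card H → ∃ P : Sylow p H, (P : Subgroup H) ≤ K) :
    K = ⊤ := by
  rw [← Subgroup.index_eq_one]
  by_contra hne
  obtain ⟨p, hp, hdvd⟩ := Nat.exists_prime_and_dvd hne
  have : Fact p.Prime := ⟨hp⟩
  obtain ⟨P, hP⟩ := hK p hp (hdvd.trans K.index_dvd_card)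
  exact P.not_dvd_index (hdvd.trans (Subgroup.index_dvd_of_le hP))

/-- N ≤ Z_∞(G) iff for every prime p dividing |N|, some Sylow p-subgroup of N
is contained in Z_∞(G). -/
theorem stmt_18 {G : Type*} [Group G] [Finite G] (N : Subgroup G) (hN : N.Normal) :
    N ≤ ⨆ n, upperCentralSeries G n ↔
      ∀ p : ℕ, p.Prime → p ∣ Nat.card ↥N →
        ∃ P : Sylow p ↥N, (P : Subgroup ↥N).map N.subtype ≤ ⨆ n, upperCentralSeries G n := by
  constructor
  · intro h p _ _
    exact ⟨default, (Subgroup.map_subtype_le _).trans h⟩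
  · intro h
    rw [← Subgroup.subgroupOf_eq_top]
    refine Subgroup.eq_top_of_forall_exists_sylow_le _ fun p hp hdvd => ?_
    obtain ⟨P, hP⟩ := h p hp hdvd
    exact ⟨P, Subgroup.map_le_iff_le_comap.mp hP⟩
end
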